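/- In the setting of the higher-dimensional boundary construction (U = {x ∈ ℝ^N_+ : |x| < ρ}, L_h f = −h² a^{jk} ∂_j∂_k f − i h (b^j + h b₁^j) ∂_j f + (c + h c₁ + h² c₂) f with C^∞ coefficients, C^∞ positive density v, semiclassical principal symbol σ(x,ξ) = a^{jk}(x)ξ_jξ_k + b^j(x)ξ_j + c(x)), let u, w be C^∞ complex-valued functions on ∂U = {x ∈ U : x^N = 0} with u(0) and w(0) not both zero, and impose the boundary conditions h u(x′) ∂_N f(x′,0) + w(x′) f(x′,0) = 0. Let ξ′ ∈ ℝ^{N−1}, z ∈ ℂ, and suppose the two solutions ξ_N, ξ̃_N of the quadratic equation σ(0,(ξ′,s)) = z in s ∈ ℂ are distinct and both have positive imaginary part. Then there exist constants c > 0, c′ > 0, C > 0 and, for every sufficiently small h > 0, a smooth function g_h on U satisfying the boundary conditions, with supp(g_h) ⊆ {x ∈ U : |x| < c′ h^{1/2}}, lim_{h→0+} ‖g_h‖_{L²(v dx)} = c, and ‖L_h g_h − z g_h‖_{L²(v dx)} ≤ C h^{1/2}. -/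

import Mathlib

open MeasureTheory
open scoped ENNReal Topology

/-- Coordinate basis vectors of the half-space model `ℝ^N × ℝ` of `ℝ^{N+1}_+`,
the last coordinate being normal to the boundary. -/
noncomputable def coordVec (N : ℕ) (i : Fin (N + 1)) : EuclideanSpace ℝ (Fin N) × ℝ :=
  if h : (i : ℕ) < N then (EuclideanSpace.single ⟨i, h⟩ 1, 0) else (0, 1)

/-- Partial derivative in the `i`-th coordinate direction. -/
noncomputable def pderivC (N : ℕ) (i : Fin (N + 1))
    (f : EuclideanSpace ℝ (Fin N) × ℝ → ℂ) (x : EuclideanSpace ℝ (Fin N) × ℝ) : ℂ :=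
  fderiv ℝ f x (coordVec N i)

/-- The half-ball `U = {x ∈ ℝ^{N+1}_+ : |x| < ρ}` in the half-space model. -/
def halfBall (N : ℕ) (ρ : ℝ) : Set (EuclideanSpace ℝ (Fin N) × ℝ) :=
  {x | 0 ≤ x.2 ∧ Real.sqrt (‖x.1‖^2 + x.2^2) < ρ}

/-- The full complex covector `(ξ', ξ_N)` built from a real tangential part `ξ'` and a
complex normal component `ξN`. -/
noncomputable def fullCovec (N : ℕ) (ξ' : Fin N → ℝ) (ξN : ℂ) (i : Fin (N + 1)) : ℂ :=
  if h : (i : ℕ) < N then ((ξ' ⟨i, h⟩ : ℝ) : ℂ) else ξN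

section Calculus

variable {N : ℕ}

lemma ContDiff.pderivC {f : EuclideanSpace ℝ (Fin N) × ℝ → ℂ}
    (hf : ContDiff ℝ (⊤ : ℕ∞) f) (k : Fin (N + 1)) :
    ContDiff ℝ (⊤ : ℕ∞) (pderivC N k f) := by
  unfold _root_.pderivC
  exact (hf.fderiv_right (m := (⊤ : ℕ∞)) (by simp)).clm_apply contDiff_const

lemma pderivC_add {f g : EuclideanSpace ℝ (Fin N) × ℝ → ℂ}
    (hf : ContDiff ℝ (⊤ : ℕ∞) f) (hg : ContDiff ℝ (⊤ : ℕ∞) g) (k : Fin (N + 1)) :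
    pderivC N k (fun x => f x + g x) = fun x => pderivC N k f x + pderivC N k g x := by
  funext x
  have h1 := hf.differentiable (by simp) x
  have h2 := hg.differentiable (by simp) x
  simp [pderivC, fderiv_fun_add h1 h2]

lemma pderivC_mul {f g : EuclideanSpace ℝ (Fin N) × ℝ → ℂ}
    (hf : ContDiff ℝ (⊤ : ℕ∞) f) (hg : ContDiff ℝ (⊤ : ℕ∞) g) (k : Fin (N + 1)) :
    pderivC N k (fun x => f x * g x)
      = fun x => pderivC N k f x * g x + f x * pderivC N k g x := by
  funext x
  have h1 := hf.differentiable (by simp) x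
  have h2 := hg.differentiable (by simp) x
  simp [pderivC, fderiv_fun_mul h1 h2]
  ring

lemma pderivC_const_mul {f : EuclideanSpace ℝ (Fin N) × ℝ → ℂ}
    (hf : ContDiff ℝ (⊤ : ℕ∞) f) (n : ℂ) (k : Fin (N + 1)) :
    pderivC N k (fun x => n * f x) = fun x => n * pderivC N k f x := by
  funext x
  rw [pderivC_mul contDiff_const hf]
  simp [pderivC]

lemma pderivC_comp_smul {f : EuclideanSpace ℝ (Fin N) × ℝ → ℂ}
    (hf : ContDiff ℝ (⊤ : ℕ∞) f) (r : ℝ) (k : Fin (N + 1)) :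
    pderivC N k (fun x => f (r • x)) = fun x => (r : ℂ) * pderivC N k f (r • x) := by
  funext x
  have h1 : HasFDerivAt f (fderiv ℝ f (r • x)) (r • x) :=
    (hf.differentiable (by simp) _).hasFDerivAt
  have h2 : HasFDerivAt (fun x : EuclideanSpace ℝ (Fin N) × ℝ => r • x)
      (r • ContinuousLinearMap.id ℝ _) x := (hasFDerivAt_id x).const_smul r
  have h3 : HasFDerivAt (fun x => f (r • x)) _ x := h1.comp x h2
  simp [pderivC, h3.fderiv]

lemma pderivC_cexp (L : EuclideanSpace ℝ (Fin N) × ℝ →L[ℝ] ℂ) (k : Fin (N + 1)) :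
    pderivC N k (fun x => Complex.exp (L x))
      = fun x => L (coordVec N k) * Complex.exp (L x) := by
  funext x
  have h : HasFDerivAt (fun x => Complex.exp (L x)) _ x := L.hasFDerivAt.cexp
  simp [pderivC, h.fderiv]
  ring

lemma pderivC_mul_cexp {A : EuclideanSpace ℝ (Fin N) × ℝ → ℂ} (hA : ContDiff ℝ (⊤ : ℕ∞) A)
    (L : EuclideanSpace ℝ (Fin N) × ℝ →L[ℝ] ℂ) (k : Fin (N + 1)) :
    pderivC N k (fun x => A x * Complex.exp (L x))
      = fun x => (pderivC N k A x + L (coordVec N k) * A x) * Complex.exp (L x) := by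
  have hL : ContDiff ℝ (⊤ : ℕ∞) (fun x => Complex.exp (L x)) := L.contDiff.cexp
  rw [pderivC_mul hA hL, pderivC_cexp]
  funext x
  ring

lemma pderivC_pderivC_mul_cexp {A : EuclideanSpace ℝ (Fin N) × ℝ → ℂ}
    (hA : ContDiff ℝ (⊤ : ℕ∞) A)
    (L : EuclideanSpace ℝ (Fin N) × ℝ →L[ℝ] ℂ) (j k : Fin (N + 1)) :
    pderivC N j (pderivC N k (fun x => A x * Complex.exp (L x)))
      = fun x => (pderivC N j (pderivC N k A) x + L (coordVec N k) * pderivC N j A x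
          + L (coordVec N j) * pderivC N k A x
          + L (coordVec N j) * L (coordVec N k) * A x) * Complex.exp (L x) := by
  rw [pderivC_mul_cexp hA]
  have h1 : ContDiff ℝ (⊤ : ℕ∞) (fun x => L (coordVec N k) * A x) := contDiff_const.mul hA
  rw [pderivC_mul_cexp ((hA.pderivC k).add h1), pderivC_add (hA.pderivC k) h1,
    pderivC_const_mul hA]
  funext x
  ring

lemma pderivC_congr_nhds {f g : EuclideanSpace ℝ (Fin N) × ℝ → ℂ}
    {x : EuclideanSpace ℝ (Fin N) × ℝ} (h : f =ᶠ[𝓝 x] g) (k : Fin (N + 1)) :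
    pderivC N k f =ᶠ[𝓝 x] pderivC N k g := by
  filter_upwards [h.fderiv (𝕜 := ℝ)] with y hy
  simp [pderivC, hy]

/-- The function `L_h f - z f`. -/
noncomputable def semiclassicalDefect (N : ℕ)
    (a : Fin (N+1) → Fin (N+1) → EuclideanSpace ℝ (Fin N) × ℝ → ℂ)
    (b b₁ : Fin (N+1) → EuclideanSpace ℝ (Fin N) × ℝ → ℂ)
    (c c₁ c₂ : EuclideanSpace ℝ (Fin N) × ℝ → ℂ) (z : ℂ) (h : ℝ)
    (f : EuclideanSpace ℝ (Fin N) × ℝ → ℂ) (x : EuclideanSpace ℝ (Fin N) × ℝ) : ℂ :=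
  (-(h:ℂ)^2 * ∑ j, ∑ k, a j k x * pderivC N j (pderivC N k f) x
    - Complex.I * (h:ℂ) * ∑ j, (b j x + (h:ℂ) * b₁ j x) * pderivC N j f x
    + (c x + (h:ℂ) * c₁ x + (h:ℂ)^2 * c₂ x) * f x)
  - z * f x

/-- The semiclassical principal symbol at the point `x` and the covector `ξ`. -/
noncomputable def principalSymbol (N : ℕ)
    (a : Fin (N+1) → Fin (N+1) → EuclideanSpace ℝ (Fin N) × ℝ → ℂ)
    (b : Fin (N+1) → EuclideanSpace ℝ (Fin N) × ℝ → ℂ)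
    (c : EuclideanSpace ℝ (Fin N) × ℝ → ℂ) (ξ : Fin (N+1) → ℂ)
    (x : EuclideanSpace ℝ (Fin N) × ℝ) : ℂ :=
  (∑ j, ∑ k, a j k x * ξ j * ξ k) + (∑ j, b j x * ξ j) + c x

variable (a : Fin (N+1) → Fin (N+1) → EuclideanSpace ℝ (Fin N) × ℝ → ℂ)
    (b b₁ : Fin (N+1) → EuclideanSpace ℝ (Fin N) × ℝ → ℂ)
    (c c₁ c₂ : EuclideanSpace ℝ (Fin N) × ℝ → ℂ) (z : ℂ) (h : ℝ)

lemma semiclassicalDefect_const_mul_add {f g : EuclideanSpace ℝ (Fin N) × ℝ → ℂ}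
    (hf : ContDiff ℝ (⊤ : ℕ∞) f) (hg : ContDiff ℝ (⊤ : ℕ∞) g) (n : ℂ)
    (x : EuclideanSpace ℝ (Fin N) × ℝ) :
    semiclassicalDefect N a b b₁ c c₁ c₂ z h (fun x => n * (f x + g x)) x
      = n * (semiclassicalDefect N a b b₁ c c₁ c₂ z h f x
        + semiclassicalDefect N a b b₁ c c₁ c₂ z h g x) := by
  have h1 (k : Fin (N + 1)) : pderivC N k (fun x => n * (f x + g x))
      = fun x => n * (pderivC N k f x + pderivC N k g x) := by
    rw [pderivC_const_mul (hf.add hg), pderivC_add hf hg]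
  have h2 (j k : Fin (N + 1)) : pderivC N j (pderivC N k (fun x => n * (f x + g x)))
      = fun x => n * (pderivC N j (pderivC N k f) x + pderivC N j (pderivC N k g) x) := by
    rw [h1, pderivC_const_mul ((hf.pderivC k).add (hg.pderivC k)),
      pderivC_add (hf.pderivC k) (hg.pderivC k)]
  simp only [semiclassicalDefect, h2]
  simp only [h1, mul_left_comm _ n, ← Finset.mul_sum]
  simp only [mul_add, Finset.sum_add_distrib]
  ring

lemma semiclassicalDefect_eq_zero_of_eventuallyEq {f : EuclideanSpace ℝ (Fin N) × ℝ → ℂ}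
    {x : EuclideanSpace ℝ (Fin N) × ℝ} (hf : f =ᶠ[𝓝 x] 0) :
    semiclassicalDefect N a b b₁ c c₁ c₂ z h f x = 0 := by
  have h0 (k : Fin (N + 1)) : pderivC N k (0 : EuclideanSpace ℝ (Fin N) × ℝ → ℂ) = 0 := by
    funext y; simp [pderivC]
  have h1 (k : Fin (N + 1)) : pderivC N k f =ᶠ[𝓝 x] 0 := by
    simpa [h0] using pderivC_congr_nhds hf k
  have h2 (j k : Fin (N + 1)) : pderivC N j (pderivC N k f) =ᶠ[𝓝 x] 0 := by
    simpa [h0] using pderivC_congr_nhds (h1 k) j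
  simp [semiclassicalDefect, hf.eq_of_nhds, (h1 _).eq_of_nhds, (h2 _ _).eq_of_nhds]

lemma semiclassicalDefect_mul_cexp {A : EuclideanSpace ℝ (Fin N) × ℝ → ℂ}
    (hA : ContDiff ℝ (⊤ : ℕ∞) A) (hh : h ≠ 0)
    (L : EuclideanSpace ℝ (Fin N) × ℝ →L[ℝ] ℂ) (ξ : Fin (N + 1) → ℂ)
    (hL : ∀ k, L (coordVec N k) = Complex.I * ξ k / h) (x : EuclideanSpace ℝ (Fin N) × ℝ) :
    semiclassicalDefect N a b b₁ c c₁ c₂ z h (fun x => A x * Complex.exp (L x)) x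
      = ((principalSymbol N a b c ξ x - z) * A x
        + (∑ j, ∑ k, a j k x * (-(h : ℂ)^2 * pderivC N j (pderivC N k A) x
            - Complex.I * h * (ξ k * pderivC N j A x + ξ j * pderivC N k A x)))
        + (∑ j, (-Complex.I * h * (b j x + h * b₁ j x) * pderivC N j A x
            + h * b₁ j x * ξ j * A x))
        + (h * c₁ x + (h : ℂ)^2 * c₂ x) * A x) * Complex.exp (L x) := by
  have hh' : (h : ℂ) ≠ 0 := by exact_mod_cast hh
  have e1 : (h:ℂ)^2 * ∑ j, ∑ k, a j k x *
      pderivC N j (pderivC N k (fun x => A x * Complex.exp (L x))) x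
      = (∑ j, ∑ k, (a j k x * ((h : ℂ)^2 * pderivC N j (pderivC N k A) x
            + Complex.I * h * (ξ k * pderivC N j A x + ξ j * pderivC N k A x))
            - a j k x * ξ j * ξ k * A x)) * Complex.exp (L x) := by
    simp only [Finset.mul_sum, Finset.sum_mul]
    refine Finset.sum_congr rfl fun j _ => Finset.sum_congr rfl fun k _ => ?_
    rw [pderivC_pderivC_mul_cexp hA, hL, hL]
    field_simp
    linear_combination (a j k x * ξ j * ξ k * A x) * Complex.I_sq
  have e2 : Complex.I * (h:ℂ) * ∑ j, (b j x + (h:ℂ) * b₁ j x) *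
      pderivC N j (fun x => A x * Complex.exp (L x)) x
      = (∑ j, (Complex.I * h * (b j x + h * b₁ j x) * pderivC N j A x
            - h * b₁ j x * ξ j * A x - b j x * ξ j * A x)) * Complex.exp (L x) := by
    simp only [Finset.mul_sum, Finset.sum_mul]
    refine Finset.sum_congr rfl fun j _ => ?_
    rw [pderivC_mul_cexp hA, hL]
    field_simp
    linear_combination ((b j x + h * b₁ j x) * ξ j * A x) * Complex.I_sq
  have e3 : (∑ j, ∑ k, a j k x * (-(h : ℂ)^2 * pderivC N j (pderivC N k A) x
            - Complex.I * h * (ξ k * pderivC N j A x + ξ j * pderivC N k A x)))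
      = - ∑ j, ∑ k, (a j k x * ((h : ℂ)^2 * pderivC N j (pderivC N k A) x
            + Complex.I * h * (ξ k * pderivC N j A x + ξ j * pderivC N k A x))) := by
    simp only [← Finset.sum_neg_distrib]
    refine Finset.sum_congr rfl fun j _ => Finset.sum_congr rfl fun k _ => ?_
    ring
  have e4 : (∑ j, (-Complex.I * h * (b j x + h * b₁ j x) * pderivC N j A x
            + h * b₁ j x * ξ j * A x))
      = - ∑ j, (Complex.I * h * (b j x + h * b₁ j x) * pderivC N j A x
            - h * b₁ j x * ξ j * A x) := by
    simp only [← Finset.sum_neg_distrib]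
    refine Finset.sum_congr rfl fun j _ => ?_
    ring
  rw [e3, e4]
  simp only [semiclassicalDefect, neg_mul, e1, e2, principalSymbol]
  simp only [Finset.sum_sub_distrib, ← Finset.sum_mul]
  ring

end Calculus

section Bounds

variable {N : ℕ}

lemma zero_mem_halfBall {ρ : ℝ} (hρ : 0 < ρ) : (0 : EuclideanSpace ℝ (Fin N) × ℝ) ∈ halfBall N ρ := by
  simp [halfBall, hρ]

lemma exists_pderivC_bounds_closedBall {f : EuclideanSpace ℝ (Fin N) × ℝ → ℂ}
    (hf : ContDiff ℝ (⊤ : ℕ∞) f) :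
    ∃ M, 0 ≤ M ∧ ∀ x, ‖x‖ ≤ 1 → ‖f x‖ ≤ M ∧ (∀ j, ‖pderivC N j f x‖ ≤ M) ∧
      ∀ j k, ‖pderivC N j (pderivC N k f) x‖ ≤ M := by
  have hcpt : IsCompact (Metric.closedBall (0 : EuclideanSpace ℝ (Fin N) × ℝ) 1) :=
    isCompact_closedBall _ _
  obtain ⟨M₀, hM₀⟩ := hcpt.exists_bound_of_continuousOn hf.continuous.continuousOn
  obtain ⟨M₁, hM₁⟩ := hcpt.exists_bound_of_continuousOn
    (f := fun x j => pderivC N j f x)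
    (continuous_pi fun j => (hf.pderivC j).continuous).continuousOn
  obtain ⟨M₂, hM₂⟩ := hcpt.exists_bound_of_continuousOn
    (f := fun x j k => pderivC N j (pderivC N k f) x)
    (continuous_pi fun j => continuous_pi fun k =>
      ((hf.pderivC k).pderivC j).continuous).continuousOn
  refine ⟨|M₀| + |M₁| + |M₂|, by positivity, fun x hx => ?_⟩
  have hx' : x ∈ Metric.closedBall (0 : EuclideanSpace ℝ (Fin N) × ℝ) 1 := by simpa using hx
  have h0 := (hM₀ x hx').trans (le_abs_self _)
  have h1 := (hM₁ x hx').trans (le_abs_self _)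
  have h2 := (hM₂ x hx').trans (le_abs_self _)
  have p0 := abs_nonneg M₀
  have p1 := abs_nonneg M₁
  have p2 := abs_nonneg M₂
  refine ⟨by linarith, fun j => ?_, fun j k => ?_⟩
  · have := norm_le_pi_norm (fun j => pderivC N j f x) j
    linarith
  · have e1 := norm_le_pi_norm (fun j k => pderivC N j (pderivC N k f) x) j
    have e2 := norm_le_pi_norm (fun k => pderivC N j (pderivC N k f) x) k
    linarith

lemma exists_rescaled_amplitude_bounds {B α : EuclideanSpace ℝ (Fin N) × ℝ → ℂ}
    (hB : ContDiff ℝ (⊤ : ℕ∞) B) (hα : ContDiff ℝ (⊤ : ℕ∞) α) :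
    ∃ M, 0 ≤ M ∧ ∀ s : ℝ, 0 < s → s ≤ 1 → ∀ x, ‖x‖ ≤ s →
      ‖B (s⁻¹ • x) * α x‖ ≤ M ∧
      (∀ j, ‖pderivC N j (fun x => B (s⁻¹ • x) * α x) x‖ ≤ M / s) ∧
      ∀ j k, ‖pderivC N j (pderivC N k (fun x => B (s⁻¹ • x) * α x)) x‖ ≤ M / s ^ 2 := by
  obtain ⟨P, hP, hPB⟩ := exists_pderivC_bounds_closedBall hB
  obtain ⟨Q, hQ, hQα⟩ := exists_pderivC_bounds_closedBall hα
  refine ⟨4 * (P * Q), by positivity, fun s hs hs1 x hx => ?_⟩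
  obtain ⟨α0, α1, α2⟩ := hQα x (hx.trans hs1)
  obtain ⟨B0, B1, B2⟩ := hPB (s⁻¹ • x) (by
    rw [norm_smul, norm_inv, Real.norm_of_nonneg hs.le, inv_mul_le_iff₀ hs]
    simpa using hx)
  have hPQ : 0 ≤ P * Q := by positivity
  have hr : 1 ≤ s⁻¹ := (one_le_inv₀ hs).2 hs1
  have hrs : ‖((s⁻¹ : ℝ) : ℂ)‖ = s⁻¹ := by
    rw [Complex.norm_real, Real.norm_of_nonneg (by positivity)]
  have hBs (C : EuclideanSpace ℝ (Fin N) × ℝ → ℂ) (hC : ContDiff ℝ (⊤ : ℕ∞) C) :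
      ContDiff ℝ (⊤ : ℕ∞) (fun x => C (s⁻¹ • x)) := hC.comp (contDiff_const_smul _)
  have d1 (k : Fin (N + 1)) : pderivC N k (fun x => B (s⁻¹ • x) * α x)
      = fun x => ((s⁻¹ : ℝ) : ℂ) * pderivC N k B (s⁻¹ • x) * α x
        + B (s⁻¹ • x) * pderivC N k α x := by
    rw [pderivC_mul (hBs B hB) hα, pderivC_comp_smul hB]
  have d2 (j k : Fin (N + 1)) : pderivC N j (pderivC N k (fun x => B (s⁻¹ • x) * α x))
      = fun x => ((s⁻¹ : ℝ) : ℂ) * (((s⁻¹ : ℝ) : ℂ) * pderivC N j (pderivC N k B) (s⁻¹ • x)) * α x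
        + ((s⁻¹ : ℝ) : ℂ) * pderivC N k B (s⁻¹ • x) * pderivC N j α x
        + (((s⁻¹ : ℝ) : ℂ) * pderivC N j B (s⁻¹ • x) * pderivC N k α x
        + B (s⁻¹ • x) * pderivC N j (pderivC N k α) x) := by
    have e1 : ContDiff ℝ (⊤ : ℕ∞)
        (fun x => ((s⁻¹ : ℝ) : ℂ) * pderivC N k B (s⁻¹ • x)) :=
      contDiff_const.mul (hBs _ (hB.pderivC k))
    rw [d1, pderivC_add (e1.mul hα) ((hBs B hB).mul (hα.pderivC k)), pderivC_mul e1 hα,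
      pderivC_mul (hBs B hB) (hα.pderivC k), pderivC_const_mul (hBs _ (hB.pderivC k)),
      pderivC_comp_smul (hB.pderivC k), pderivC_comp_smul hB]
  refine ⟨?_, fun j => ?_, fun j k => ?_⟩
  · rw [norm_mul]
    have := mul_le_mul B0 α0 (norm_nonneg _) hP
    linarith
  · rw [d1]
    have e1 : ‖((s⁻¹ : ℝ) : ℂ) * pderivC N j B (s⁻¹ • x) * α x‖ ≤ s⁻¹ * P * Q := by
      rw [norm_mul, norm_mul, hrs]
      gcongr
      exact B1 j
    have e2 : ‖B (s⁻¹ • x) * pderivC N j α x‖ ≤ 1 * P * Q := by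
      rw [norm_mul, one_mul]
      gcongr
      exact α1 j
    have e3 := (norm_add_le _ _).trans (add_le_add e1 e2)
    refine e3.trans ?_
    rw [div_eq_mul_inv]
    nlinarith
  · rw [d2]
    have e1 : ‖((s⁻¹ : ℝ) : ℂ) * (((s⁻¹ : ℝ) : ℂ) * pderivC N j (pderivC N k B) (s⁻¹ • x)) * α x‖
        ≤ s⁻¹ * (s⁻¹ * P) * Q := by
      rw [norm_mul, norm_mul, norm_mul, hrs]
      gcongr
      exact B2 j k
    have e2 : ‖((s⁻¹ : ℝ) : ℂ) * pderivC N k B (s⁻¹ • x) * pderivC N j α x‖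
        ≤ s⁻¹ * (s⁻¹ * P) * Q := by
      rw [norm_mul, norm_mul, hrs]
      gcongr
      · nlinarith [B1 k]
      · exact α1 j
    have e3 : ‖((s⁻¹ : ℝ) : ℂ) * pderivC N j B (s⁻¹ • x) * pderivC N k α x‖
        ≤ s⁻¹ * (s⁻¹ * P) * Q := by
      rw [norm_mul, norm_mul, hrs]
      gcongr
      · nlinarith [B1 j]
      · exact α1 k
    have e4 : ‖B (s⁻¹ • x) * pderivC N j (pderivC N k α) x‖ ≤ s⁻¹ * (s⁻¹ * P) * Q := by
      rw [norm_mul]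
      gcongr
      · nlinarith [mul_nonneg (sub_nonneg.2 hr) hP]
      · exact α2 j k
    have e5 := (norm_add_le _ _).trans (add_le_add
      ((norm_add_le _ _).trans (add_le_add e1 e2)) ((norm_add_le _ _).trans (add_le_add e3 e4)))
    refine e5.trans (le_of_eq ?_)
    rw [div_eq_mul_inv, ← inv_pow]
    ring

lemma norm_semiclassicalDefect_mul_cexp_le
    (a : Fin (N+1) → Fin (N+1) → EuclideanSpace ℝ (Fin N) × ℝ → ℂ)
    (b b₁ : Fin (N+1) → EuclideanSpace ℝ (Fin N) × ℝ → ℂ)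
    (c c₁ c₂ : EuclideanSpace ℝ (Fin N) × ℝ → ℂ) (z : ℂ)
    {A : EuclideanSpace ℝ (Fin N) × ℝ → ℂ} (hA : ContDiff ℝ (⊤ : ℕ∞) A)
    (L : EuclideanSpace ℝ (Fin N) × ℝ →L[ℝ] ℂ) (ξ : Fin (N + 1) → ℂ)
    {s K M : ℝ} (hs : 0 < s) (hs1 : s ≤ 1) (hK : 0 ≤ K) (hM : 0 ≤ M)
    (hL : ∀ k, L (coordVec N k) = Complex.I * ξ k / ((s ^ 2 : ℝ) : ℂ))
    (x : EuclideanSpace ℝ (Fin N) × ℝ)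
    (ha : ∀ j k, ‖a j k x‖ ≤ K) (hb : ∀ j, ‖b j x‖ ≤ K) (hb₁ : ∀ j, ‖b₁ j x‖ ≤ K)
    (hc₁ : ‖c₁ x‖ ≤ K) (hc₂ : ‖c₂ x‖ ≤ K) (hξ : ∀ j, ‖ξ j‖ ≤ K)
    (hσ : ‖principalSymbol N a b c ξ x - z‖ ≤ K * s)
    (hA0 : ‖A x‖ ≤ M) (hA1 : ∀ j, ‖pderivC N j A x‖ ≤ M / s)
    (hA2 : ∀ j k, ‖pderivC N j (pderivC N k A) x‖ ≤ M / s ^ 2) :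
    ‖semiclassicalDefect N a b b₁ c c₁ c₂ z (s ^ 2) (fun x => A x * Complex.exp (L x)) x‖
      ≤ (K + (N + 1) * ((N + 1) * (K * (1 + 2 * K))) + (N + 1) * (2 * K + K ^ 2) + 2 * K)
        * M * s * ‖Complex.exp (L x)‖ := by
  rw [semiclassicalDefect_mul_cexp a b b₁ c c₁ c₂ z (s ^ 2) hA (by positivity) L ξ hL, norm_mul]
  gcongr
  have hsC : ‖((s ^ 2 : ℝ) : ℂ)‖ = s ^ 2 := by
    rw [Complex.norm_real, Real.norm_of_nonneg (by positivity)]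
  have hs2 : s ^ 2 ≤ s := by nlinarith
  have hs2' : s ^ 2 ≤ 1 := by nlinarith
  have hMs : s ^ 2 * (M / s) = M * s := by field_simp
  have t1 : ‖(principalSymbol N a b c ξ x - z) * A x‖ ≤ K * M * s := by
    rw [norm_mul]
    calc _ ≤ K * s * M := by gcongr
      _ = _ := by ring
  have t2 (j k : Fin (N + 1)) : ‖a j k x * (-((s ^ 2 : ℝ) : ℂ)^2 * pderivC N j (pderivC N k A) x
            - Complex.I * ((s ^ 2 : ℝ) : ℂ) * (ξ k * pderivC N j A x + ξ j * pderivC N k A x))‖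
      ≤ K * (1 + 2 * K) * M * s := by
    rw [norm_mul]
    have e1 : ‖-((s ^ 2 : ℝ) : ℂ)^2 * pderivC N j (pderivC N k A) x‖ ≤ M * s := by
      rw [norm_mul, norm_neg, norm_pow, hsC]
      calc _ ≤ (s ^ 2) ^ 2 * (M / s ^ 2) := by gcongr; exact hA2 j k
        _ = M * s ^ 2 := by field_simp
        _ ≤ _ := by gcongr
    have e2 : ‖Complex.I * ((s ^ 2 : ℝ) : ℂ) * (ξ k * pderivC N j A x + ξ j * pderivC N k A x)‖
        ≤ 2 * K * M * s := by
      rw [norm_mul, norm_mul, Complex.norm_I, hsC, one_mul]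
      calc _ ≤ s ^ 2 * (K * (M / s) + K * (M / s)) := by
            gcongr
            refine (norm_add_le _ _).trans ?_
            rw [norm_mul, norm_mul]
            gcongr
            exacts [hξ k, hA1 j, hξ j, hA1 k]
        _ = 2 * K * (s ^ 2 * (M / s)) := by ring
        _ = _ := by rw [hMs]; ring
    calc _ ≤ K * (M * s + 2 * K * M * s) := by
          gcongr
          · exact ha j k
          · exact (norm_sub_le _ _).trans (add_le_add e1 e2)
      _ = _ := by ring
  have t3 (j : Fin (N + 1)) : ‖-Complex.I * ((s ^ 2 : ℝ) : ℂ) * (b j x + ((s ^ 2 : ℝ) : ℂ) * b₁ j x)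
        * pderivC N j A x + ((s ^ 2 : ℝ) : ℂ) * b₁ j x * ξ j * A x‖
      ≤ (2 * K + K ^ 2) * M * s := by
    have e0 : ‖b j x + ((s ^ 2 : ℝ) : ℂ) * b₁ j x‖ ≤ 2 * K := by
      refine (norm_add_le _ _).trans ?_
      rw [norm_mul, hsC]
      calc _ ≤ K + 1 * K := by gcongr; exacts [hb j, hb₁ j]
        _ = _ := by ring
    have e1 : ‖-Complex.I * ((s ^ 2 : ℝ) : ℂ) * (b j x + ((s ^ 2 : ℝ) : ℂ) * b₁ j x)
        * pderivC N j A x‖ ≤ 2 * K * M * s := by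
      rw [norm_mul, norm_mul, norm_mul, norm_neg, Complex.norm_I, hsC, one_mul]
      calc _ ≤ s ^ 2 * (2 * K) * (M / s) := by gcongr; exact hA1 j
        _ = 2 * K * (s ^ 2 * (M / s)) := by ring
        _ = _ := by rw [hMs]; ring
    have e2 : ‖((s ^ 2 : ℝ) : ℂ) * b₁ j x * ξ j * A x‖ ≤ K ^ 2 * M * s := by
      rw [norm_mul, norm_mul, norm_mul, hsC]
      calc _ ≤ s * K * K * M := by gcongr; exacts [hb₁ j, hξ j]
        _ = _ := by ring
    refine (norm_add_le _ _).trans ((add_le_add e1 e2).trans (le_of_eq ?_))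
    ring
  have t4 : ‖(((s ^ 2 : ℝ) : ℂ) * c₁ x + ((s ^ 2 : ℝ) : ℂ)^2 * c₂ x) * A x‖ ≤ 2 * K * M * s := by
    rw [norm_mul]
    calc _ ≤ (s * K + s * K) * M := by
          gcongr
          refine (norm_add_le _ _).trans ?_
          rw [norm_mul, norm_mul, norm_pow, hsC]
          gcongr
          nlinarith
      _ = _ := by ring
  have S2 := norm_sum_le_of_le Finset.univ fun j _ =>
    norm_sum_le_of_le Finset.univ fun k _ => t2 j k
  have S3 := norm_sum_le_of_le Finset.univ fun j _ => t3 j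
  simp only [Finset.sum_const, Finset.card_univ, Fintype.card_fin, nsmul_eq_mul] at S2 S3
  refine (norm_add_le_of_le (norm_add_le_of_le (norm_add_le_of_le t1 S2) S3) t4).trans
    (le_of_eq ?_)
  push_cast
  ring

lemma ContDiffOn.eventually_norm_le_and_norm_sub_le {E F : Type*} [NormedAddCommGroup E]
    [NormedSpace ℝ E] [NormedAddCommGroup F] [NormedSpace ℝ F] {f : E → F} {U : Set E}
    (hf : ContDiffOn ℝ (⊤ : ℕ∞) f U) (h0 : 0 ∈ U) :
    ∃ K, 0 ≤ K ∧ ∀ᶠ x in 𝓝[U] 0, ‖f x‖ ≤ K ∧ ‖f x - f 0‖ ≤ K * ‖x‖ := by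
  obtain ⟨K, hK⟩ := ((hf.differentiableOn (by simp)) 0 h0).isBigO_sub.bound
  have hcont : ∀ᶠ x in 𝓝[U] 0, ‖f x‖ < ‖f 0‖ + 1 :=
    (hf.continuousOn 0 h0).norm.eventually (gt_mem_nhds (lt_add_one _))
  refine ⟨|K| + ‖f 0‖ + 1, by positivity, ?_⟩
  filter_upwards [hK, hcont] with x h1 h2
  refine ⟨by linarith [abs_nonneg K], h1.trans ?_⟩
  rw [sub_zero]
  gcongr
  linarith [le_abs_self K, norm_nonneg (f 0)]

lemma ContDiffOn.principalSymbol
    {a : Fin (N+1) → Fin (N+1) → EuclideanSpace ℝ (Fin N) × ℝ → ℂ}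
    {b : Fin (N+1) → EuclideanSpace ℝ (Fin N) × ℝ → ℂ}
    {c : EuclideanSpace ℝ (Fin N) × ℝ → ℂ} {U : Set (EuclideanSpace ℝ (Fin N) × ℝ)}
    (ha : ∀ j k, ContDiffOn ℝ (⊤ : ℕ∞) (a j k) U) (hb : ∀ j, ContDiffOn ℝ (⊤ : ℕ∞) (b j) U)
    (hc : ContDiffOn ℝ (⊤ : ℕ∞) c U) (ξ : Fin (N+1) → ℂ) :
    ContDiffOn ℝ (⊤ : ℕ∞) (principalSymbol N a b c ξ) U := by
  unfold _root_.principalSymbol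
  refine ContDiffOn.add (ContDiffOn.add ?_ ?_) hc
  · exact ContDiffOn.sum fun j _ => ContDiffOn.sum fun k _ =>
      ((ha j k).mul contDiffOn_const).mul contDiffOn_const
  · exact ContDiffOn.sum fun j _ => (hb j).mul contDiffOn_const

/-- Near the boundary point `0`, the operator applied to a rescaled amplitude times a plane wave
with characteristic covector is small, uniformly in the scale. -/
lemma exists_defect_bound {ρ : ℝ} (hρ : 0 < ρ)
    {a : Fin (N+1) → Fin (N+1) → EuclideanSpace ℝ (Fin N) × ℝ → ℂ}
    {b b₁ : Fin (N+1) → EuclideanSpace ℝ (Fin N) × ℝ → ℂ}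
    {c c₁ c₂ : EuclideanSpace ℝ (Fin N) × ℝ → ℂ}
    (ha : ∀ j k, ContDiffOn ℝ (⊤ : ℕ∞) (a j k) (halfBall N ρ))
    (hb : ∀ j, ContDiffOn ℝ (⊤ : ℕ∞) (b j) (halfBall N ρ))
    (hb₁ : ∀ j, ContDiffOn ℝ (⊤ : ℕ∞) (b₁ j) (halfBall N ρ))
    (hc : ContDiffOn ℝ (⊤ : ℕ∞) c (halfBall N ρ)) (hc₁ : ContDiffOn ℝ (⊤ : ℕ∞) c₁ (halfBall N ρ))
    (hc₂ : ContDiffOn ℝ (⊤ : ℕ∞) c₂ (halfBall N ρ)) (z : ℂ) (ξ : Fin (N + 1) → ℂ)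
    (hz : principalSymbol N a b c ξ 0 = z)
    {B α : EuclideanSpace ℝ (Fin N) × ℝ → ℂ}
    (hB : ContDiff ℝ (⊤ : ℕ∞) B) (hα : ContDiff ℝ (⊤ : ℕ∞) α) :
    ∃ C, 0 ≤ C ∧ ∃ r, 0 < r ∧ ∀ s : ℝ, 0 < s → s < r →
      ∀ L : EuclideanSpace ℝ (Fin N) × ℝ →L[ℝ] ℂ,
      (∀ k, L (coordVec N k) = Complex.I * ξ k / ((s ^ 2 : ℝ) : ℂ)) →
      ∀ x ∈ halfBall N ρ, ‖x‖ ≤ s →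
      ‖semiclassicalDefect N a b b₁ c c₁ c₂ z (s ^ 2)
        (fun x => B (s⁻¹ • x) * α x * Complex.exp (L x)) x‖ ≤ C * s * ‖Complex.exp (L x)‖ := by
  have h0 := zero_mem_halfBall (N := N) hρ
  obtain ⟨M, hM, hbd⟩ := exists_rescaled_amplitude_bounds hB hα
  obtain ⟨Ka, hKa, ea⟩ := (contDiffOn_pi.2 fun j => contDiffOn_pi.2 fun k =>
    ha j k).eventually_norm_le_and_norm_sub_le h0
  obtain ⟨Kb, hKb, eb⟩ := (contDiffOn_pi.2 hb).eventually_norm_le_and_norm_sub_le h0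
  obtain ⟨Kb₁, hKb₁, eb₁⟩ := (contDiffOn_pi.2 hb₁).eventually_norm_le_and_norm_sub_le h0
  obtain ⟨Kc₁, hKc₁, ec₁⟩ := hc₁.eventually_norm_le_and_norm_sub_le h0
  obtain ⟨Kc₂, hKc₂, ec₂⟩ := hc₂.eventually_norm_le_and_norm_sub_le h0
  obtain ⟨Kσ, hKσ, eσ⟩ :=
    (ContDiffOn.principalSymbol ha hb hc ξ).eventually_norm_le_and_norm_sub_le h0
  obtain ⟨r, hr, hev⟩ := Metric.mem_nhdsWithin_iff.1
    (ea.and <| eb.and <| eb₁.and <| ec₁.and <| ec₂.and eσ)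
  have hnξ := norm_nonneg ξ
  set K := Ka + Kb + Kb₁ + Kc₁ + Kc₂ + Kσ + ‖ξ‖ with hKdef
  have hK : 0 ≤ K := by positivity
  refine ⟨(K + (N + 1) * ((N + 1) * (K * (1 + 2 * K))) + (N + 1) * (2 * K + K ^ 2) + 2 * K) * M,
    by positivity, min r 1, by positivity, fun s hs hsr L hL x hxU hxs => ?_⟩
  have hs1 : s ≤ 1 := (hsr.trans_le (min_le_right _ _)).le
  obtain ⟨⟨xa, -⟩, ⟨xb, -⟩, ⟨xb₁, -⟩, ⟨xc₁, -⟩, ⟨xc₂, -⟩, ⟨-, xσ⟩⟩ := hev (a := x) ⟨by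
    simpa using hxs.trans_lt (hsr.trans_le (min_le_left _ _)), hxU⟩
  obtain ⟨A0, A1, A2⟩ := hbd s hs hs1 x hxs
  refine norm_semiclassicalDefect_mul_cexp_le a b b₁ c c₁ c₂ z
    (A := fun x => B (s⁻¹ • x) * α x) ((hB.comp (contDiff_const_smul _)).mul hα) L ξ hs hs1 hK hM
    hL x (fun j k => ?_) (fun j => ?_) (fun j => ?_) ?_ ?_ (fun j => ?_) ?_ A0 A1 A2
  · have e1 := norm_le_pi_norm (fun j k => a j k x) j
    have e2 := norm_le_pi_norm (fun k => a j k x) k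
    linarith
  · have := norm_le_pi_norm (fun j => b j x) j
    linarith
  · have := norm_le_pi_norm (fun j => b₁ j x) j
    linarith
  · linarith
  · linarith
  · have := norm_le_pi_norm ξ j
    linarith
  · rw [← hz]
    refine xσ.trans ?_
    gcongr
    linarith

end Bounds

section Measure

variable {N : ℕ}

lemma measurableSet_halfBall (N : ℕ) (ρ : ℝ) : MeasurableSet (halfBall N ρ) := by
  have h1 : Measurable fun x : EuclideanSpace ℝ (Fin N) × ℝ => x.2 := measurable_snd
  have h2 : Continuous fun x : EuclideanSpace ℝ (Fin N) × ℝ =>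
      Real.sqrt (‖x.1‖ ^ 2 + x.2 ^ 2) := by fun_prop
  exact (measurableSet_le measurable_const h1).inter (measurableSet_lt h2.measurable measurable_const)

/-- Anisotropic change of variables `x' = s X'`, `x^N = s² X^N`. -/
lemma lintegral_eq_lintegral_anisotropic_scaling {s : ℝ} (hs : 0 < s)
    (F : EuclideanSpace ℝ (Fin N) × ℝ → ℝ≥0∞) :
    ∫⁻ x, F x = ENNReal.ofReal (s ^ (N + 2)) *
      ∫⁻ X : EuclideanSpace ℝ (Fin N) × ℝ, F (s • X.1, s ^ 2 * X.2) := by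
  have hs2 : s ^ 2 ≠ 0 := by positivity
  let e : EuclideanSpace ℝ (Fin N) × ℝ ≃ᵐ EuclideanSpace ℝ (Fin N) × ℝ :=
    (MeasurableEquiv.smul₀ s hs.ne').prodCongr (MeasurableEquiv.smul₀ (s ^ 2) hs2)
  have hmap : Measure.map e volume
      = ENNReal.ofReal (s ^ (N + 2))⁻¹ • (volume : Measure (EuclideanSpace ℝ (Fin N) × ℝ)) := by
    have h1 := Measure.map_prod_map (volume : Measure (EuclideanSpace ℝ (Fin N)))
      (volume : Measure ℝ) (measurable_const_smul s) (measurable_const_smul (s ^ 2))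
    rw [Measure.map_addHaar_smul _ hs.ne', Measure.map_addHaar_smul _ hs2,
      Measure.prod_smul_left, Measure.prod_smul_right, smul_smul] at h1
    rw [Measure.volume_eq_prod]
    refine h1.symm.trans ?_
    congr 1
    rw [← ENNReal.ofReal_mul (abs_nonneg _), abs_of_pos (by positivity), abs_of_pos (by positivity)]
    simp
    ring_nf
  have h2 := lintegral_map_equiv (μ := volume) F e
  rw [hmap, lintegral_smul_measure, smul_eq_mul] at h2
  change _ = ENNReal.ofReal (s ^ (N + 2)) * ∫⁻ X, F (e X)
  rw [← h2, ← mul_assoc, ← ENNReal.ofReal_mul (by positivity), mul_inv_cancel₀ (by positivity)]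
  simp

/-- The weighted `L²` density of `F` on the half ball in the anisotropically scaled variables. -/
noncomputable def scaledDensity (N : ℕ) (ρ : ℝ) (v : EuclideanSpace ℝ (Fin N) × ℝ → ℝ) (s : ℝ)
    (F : EuclideanSpace ℝ (Fin N) × ℝ → ℂ) (X : EuclideanSpace ℝ (Fin N) × ℝ) : ℝ≥0∞ :=
  (halfBall N ρ).indicator
    (fun x => ENNReal.ofReal (s ^ (N + 2)) * (ENNReal.ofReal (v x) * ‖F x‖ₑ ^ 2))
    (s • X.1, s ^ 2 * X.2)

lemma eLpNorm_eq_lintegral_scaledDensity {ρ s : ℝ} (hs : 0 < s)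
    {v : EuclideanSpace ℝ (Fin N) × ℝ → ℝ} (hv : ContinuousOn v (halfBall N ρ))
    (F : EuclideanSpace ℝ (Fin N) × ℝ → ℂ) :
    eLpNorm F 2 ((volume.restrict (halfBall N ρ)).withDensity (fun x => ENNReal.ofReal (v x)))
      = (∫⁻ X, scaledDensity N ρ v s F X) ^ (1 / 2 : ℝ) := by
  have hU := measurableSet_halfBall N ρ
  rw [eLpNorm_eq_lintegral_rpow_enorm_toReal (by simp) (by simp)]
  congr 1
  · rw [lintegral_withDensity_eq_lintegral_mul_non_measurable₀ _
      (hv.aemeasurable hU).ennreal_ofReal (by simp), ← lintegral_indicator hU,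
      lintegral_eq_lintegral_anisotropic_scaling hs, ← lintegral_const_mul' _ _ (by simp)]
    refine lintegral_congr fun X => ?_
    simp only [scaledDensity, Set.indicator]
    split_ifs <;> simp

/-- The profile dominating all scaled densities. -/
noncomputable def dominatingProfile (N : ℕ) (δ : ℝ) (X : EuclideanSpace ℝ (Fin N) × ℝ) : ℝ≥0∞ :=
  (Metric.closedBall (0 : EuclideanSpace ℝ (Fin N)) 1).indicator 1 X.1 *
    (Set.Ici (0 : ℝ)).indicator (fun y => ENNReal.ofReal (Real.exp (-(2 * δ) * y))) X.2

lemma lintegral_dominatingProfile_ne_top {δ : ℝ} (hδ : 0 < δ) :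
    ∫⁻ X, dominatingProfile N δ X ≠ ∞ := by
  have hm : Measurable fun y : ℝ => ENNReal.ofReal (Real.exp (-(2 * δ) * y)) := by fun_prop
  unfold dominatingProfile
  rw [Measure.volume_eq_prod, lintegral_prod_mul
    (measurable_one.indicator measurableSet_closedBall).aemeasurable
    (hm.indicator measurableSet_Ici).aemeasurable]
  refine ENNReal.mul_ne_top ?_ ?_
  · rw [lintegral_indicator_one measurableSet_closedBall]
    exact measure_closedBall_lt_top.ne
  · rw [lintegral_indicator measurableSet_Ici, setLIntegral_congr Ioi_ae_eq_Ici.symm]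
    exact (integrableOn_exp_mul_Ioi (by linarith : -(2 * δ) < 0) 0).lintegral_lt_top.ne

lemma scaledDensity_le_dominatingProfile {ρ s C δ Mv : ℝ} (hs : 0 < s)
    {v : EuclideanSpace ℝ (Fin N) × ℝ → ℝ} {F : EuclideanSpace ℝ (Fin N) × ℝ → ℂ}
    (hv0 : ∀ x ∈ halfBall N ρ, 0 < v x)
    (hv : ∀ x ∈ halfBall N ρ, ‖x‖ ≤ s → v x ≤ Mv)
    (hF : ∀ x ∈ halfBall N ρ, ‖x‖ ≤ s →
      ‖F x‖ ≤ (Real.sqrt (s ^ (N + 2)))⁻¹ * (C * Real.exp (-(δ * (x.2 / s ^ 2)))))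
    (hF0 : ∀ x ∈ halfBall N ρ, s < ‖x‖ → F x = 0) (X : EuclideanSpace ℝ (Fin N) × ℝ) :
    scaledDensity N ρ v s F X ≤ ENNReal.ofReal (C ^ 2 * Mv) * dominatingProfile N δ X := by
  unfold scaledDensity
  by_cases hX : (s • X.1, s ^ 2 * X.2) ∈ halfBall N ρ
  swap
  · simp [hX]
  rw [Set.indicator_of_mem hX]
  rcases lt_or_ge s ‖(s • X.1, s ^ 2 * X.2)‖ with hlt | hle
  · simp [hF0 _ hX hlt]
  have hX1 : ‖X.1‖ ≤ 1 := by
    have := (norm_fst_le (s • X.1, s ^ 2 * X.2)).trans hle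
    rw [norm_smul, Real.norm_of_nonneg hs.le] at this
    exact le_of_mul_le_mul_left (by simpa using this) hs
  have hX2 : 0 ≤ X.2 := by
    have := hX.1
    simp only at this
    exact nonneg_of_mul_nonneg_right this (by positivity)
  have hprof : dominatingProfile N δ X = ENNReal.ofReal (Real.exp (-(2 * δ) * X.2)) := by
    simp [dominatingProfile, Set.indicator, hX1, hX2]
  have hvx := hv _ hX hle
  have hvp := hv0 _ hX
  have hFx := hF _ hX hle
  have hsp : 0 < s ^ (N + 2) := by positivity
  have hsq := Real.sq_sqrt hsp.le
  have hy : s ^ 2 * X.2 / s ^ 2 = X.2 := by field_simp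
  simp only [hy] at hFx
  rw [hprof, ← ENNReal.ofReal_mul (by nlinarith [sq_nonneg C]), ← ofReal_norm, ← ENNReal.ofReal_pow (norm_nonneg _),
    ← ENNReal.ofReal_mul hvp.le, ← ENNReal.ofReal_mul hsp.le]
  refine ENNReal.ofReal_le_ofReal ?_
  have hexp : Real.exp (-(2 * δ) * X.2) = Real.exp (-(δ * X.2)) ^ 2 := by
    rw [← Real.exp_nat_mul]; congr 1; push_cast; ring
  calc _ ≤ s ^ (N + 2) * (Mv * ((Real.sqrt (s ^ (N + 2)))⁻¹ * (C * Real.exp (-(δ * X.2)))) ^ 2) := by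
        gcongr
        linarith
    _ = s ^ (N + 2) * (Real.sqrt (s ^ (N + 2)) ^ 2)⁻¹ * (C ^ 2 * Mv * Real.exp (-(δ * X.2)) ^ 2) := by
        ring
    _ = _ := by rw [hsq, mul_inv_cancel₀ hsp.ne', hexp, one_mul]

end Measure

section Mode

variable {N : ℕ}

/-- A bump function equal to one on the ball of radius `1/2` and supported in the unit ball. -/
noncomputable def unitBump (E : Type*) [NormedAddCommGroup E] : ContDiffBump (0 : E) :=
  ⟨1 / 2, 1, by norm_num, by norm_num⟩

/-- A product cutoff on the half-space model. -/
noncomputable def productCutoff (N : ℕ) (x : EuclideanSpace ℝ (Fin N) × ℝ) : ℂ :=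
  ((unitBump (EuclideanSpace ℝ (Fin N)) x.1 * unitBump ℝ x.2 : ℝ) : ℂ)

lemma contDiff_productCutoff (N : ℕ) : ContDiff ℝ (⊤ : ℕ∞) (productCutoff N) := by
  unfold productCutoff
  exact Complex.ofRealCLM.contDiff.comp
    (((unitBump _).contDiff.comp contDiff_fst).mul ((unitBump _).contDiff.comp contDiff_snd))

lemma productCutoff_eq_zero {x : EuclideanSpace ℝ (Fin N) × ℝ} (hx : 1 ≤ ‖x‖) :
    productCutoff N x = 0 := by
  rw [Prod.norm_def, le_max_iff] at hx
  rcases hx with hx | hx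
  · have : unitBump (EuclideanSpace ℝ (Fin N)) x.1 = 0 :=
      (unitBump _).zero_of_le_dist (by simpa [unitBump] using hx)
    simp [productCutoff, this]
  · have : unitBump ℝ x.2 = 0 :=
      (unitBump _).zero_of_le_dist (by simpa [unitBump] using hx)
    simp [productCutoff, this]

lemma norm_productCutoff_le_one (x : EuclideanSpace ℝ (Fin N) × ℝ) : ‖productCutoff N x‖ ≤ 1 := by
  rw [productCutoff, Complex.norm_real, norm_mul, Real.norm_of_nonneg (ContDiffBump.nonneg _),
    Real.norm_of_nonneg (ContDiffBump.nonneg _)]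
  exact mul_le_one₀ (ContDiffBump.le_one _) (ContDiffBump.nonneg _) (ContDiffBump.le_one _)

lemma productCutoff_zero : productCutoff N 0 = 1 := by
  have h1 : unitBump (EuclideanSpace ℝ (Fin N)) 0 = 1 :=
    (unitBump _).one_of_mem_closedBall (by simp [unitBump])
  have h2 : unitBump ℝ 0 = 1 := (unitBump _).one_of_mem_closedBall (by simp [unitBump])
  simp [productCutoff, h1, h2]

lemma coordVec_last (N : ℕ) : coordVec N (Fin.last N) = (0, 1) := by
  simp [coordVec]

/-- The product cutoff, rescaled and multiplied by a function of the tangential variables, has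
vanishing normal derivative at the boundary. -/
lemma pderivC_last_productCutoff_mul {α : EuclideanSpace ℝ (Fin N) → ℂ}
    (hα : ContDiff ℝ (⊤ : ℕ∞) α) (s : ℝ) (x' : EuclideanSpace ℝ (Fin N)) :
    pderivC N (Fin.last N) (fun x => productCutoff N (s⁻¹ • x) * α x.1) (x', 0) = 0 := by
  have hd : ContDiff ℝ (⊤ : ℕ∞) (fun x => productCutoff N (s⁻¹ • x) * α x.1) :=
    ((contDiff_productCutoff N).comp (contDiff_const_smul _)).mul (hα.comp contDiff_fst)
  rw [pderivC, ← (hd.differentiable (by simp) _).lineDeriv_eq_fderiv, lineDeriv, coordVec_last]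
  have hlim : Filter.Tendsto (fun t : ℝ => s⁻¹ * t) (𝓝 0) (𝓝 0) := by
    simpa using (continuous_const_mul s⁻¹).tendsto (0 : ℝ)
  have hone : ∀ᶠ y in 𝓝 (0 : ℝ), unitBump ℝ y = 1 := (unitBump ℝ).eventuallyEq_one
  have hev : (fun t : ℝ => productCutoff N (s⁻¹ • ((x', (0 : ℝ)) + t • ((0 : EuclideanSpace ℝ (Fin N)), (1 : ℝ))))
      * α ((x', (0 : ℝ)) + t • ((0 : EuclideanSpace ℝ (Fin N)), (1 : ℝ))).1) =ᶠ[𝓝 0]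
      fun _ => ((unitBump (EuclideanSpace ℝ (Fin N)) (s⁻¹ • x') : ℝ) : ℂ) * α x' := by
    filter_upwards [hlim.eventually hone] with t ht
    simp [productCutoff, ht]
  rw [hev.deriv_eq]
  simp

/-- The linear phase `⟪ξ', x'⟫ + η x^N`. -/
noncomputable def linearPhase (N : ℕ) (ξ' : Fin N → ℝ) (η : ℂ) :
    EuclideanSpace ℝ (Fin N) × ℝ →L[ℝ] ℂ :=
  (Complex.ofRealCLM.comp (innerSL ℝ (WithLp.toLp 2 ξ'))).comp
      (ContinuousLinearMap.fst ℝ (EuclideanSpace ℝ (Fin N)) ℝ)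
    + η • (Complex.ofRealCLM.comp (ContinuousLinearMap.snd ℝ (EuclideanSpace ℝ (Fin N)) ℝ))

lemma linearPhase_apply (ξ' : Fin N → ℝ) (η : ℂ) (x : EuclideanSpace ℝ (Fin N) × ℝ) :
    linearPhase N ξ' η x = ((inner ℝ (WithLp.toLp 2 ξ') x.1 : ℝ) : ℂ) + η * x.2 := by
  simp [linearPhase]

lemma linearPhase_coordVec (ξ' : Fin N → ℝ) (η : ℂ) (k : Fin (N + 1)) :
    linearPhase N ξ' η (coordVec N k) = fullCovec N ξ' η k := by
  rw [linearPhase_apply]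
  unfold coordVec fullCovec
  split_ifs with h <;> simp [EuclideanSpace.inner_single_right]

/-- The exponent `i (⟪ξ', x'⟫ + η x^N) / h` at `h = s²`. -/
noncomputable def waveExponent (N : ℕ) (ξ' : Fin N → ℝ) (η : ℂ) (s : ℝ) :
    EuclideanSpace ℝ (Fin N) × ℝ →L[ℝ] ℂ :=
  (Complex.I / ((s ^ 2 : ℝ) : ℂ)) • linearPhase N ξ' η

lemma waveExponent_coordVec (ξ' : Fin N → ℝ) (η : ℂ) (s : ℝ) (k : Fin (N + 1)) :
    waveExponent N ξ' η s (coordVec N k)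
      = Complex.I * fullCovec N ξ' η k / ((s ^ 2 : ℝ) : ℂ) := by
  simp only [waveExponent, smul_apply, linearPhase_coordVec, smul_eq_mul]
  ring

lemma cexp_waveExponent (ξ' : Fin N → ℝ) (η : ℂ) (s : ℝ) (x : EuclideanSpace ℝ (Fin N) × ℝ) :
    Complex.exp (waveExponent N ξ' η s x)
      = Complex.exp (((inner ℝ (WithLp.toLp 2 ξ') x.1 / s ^ 2 : ℝ) : ℂ) * Complex.I)
        * Complex.exp (Complex.I * η * ((x.2 / s ^ 2 : ℝ) : ℂ)) := by
  rw [← Complex.exp_add]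
  congr 1
  simp only [waveExponent, smul_apply, linearPhase_apply, smul_eq_mul]
  push_cast
  ring

lemma norm_cexp_I_mul (η : ℂ) (y : ℝ) :
    ‖Complex.exp (Complex.I * η * (y : ℂ))‖ = Real.exp (-(η.im * y)) := by
  rw [Complex.norm_exp]
  simp

lemma norm_cexp_waveExponent (ξ' : Fin N → ℝ) (η : ℂ) (s : ℝ)
    (x : EuclideanSpace ℝ (Fin N) × ℝ) :
    ‖Complex.exp (waveExponent N ξ' η s x)‖ = Real.exp (-(η.im * (x.2 / s ^ 2))) := by
  rw [cexp_waveExponent, norm_mul, Complex.norm_exp_ofReal_mul_I, one_mul, norm_cexp_I_mul]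

/-- The normalized pseudo-eigenfunction at `h = s²`: a cutoff at scale `s` times a combination of
two plane waves. -/
noncomputable def boundaryMode (N : ℕ) (ξ' : Fin N → ℝ) (η θ : ℂ)
    (α β : EuclideanSpace ℝ (Fin N) → ℂ) (s : ℝ) (x : EuclideanSpace ℝ (Fin N) × ℝ) : ℂ :=
  (((Real.sqrt (s ^ (N + 2)))⁻¹ : ℝ) : ℂ) *
    (productCutoff N (s⁻¹ • x) * α x.1 * Complex.exp (waveExponent N ξ' η s x)
      + productCutoff N (s⁻¹ • x) * β x.1 * Complex.exp (waveExponent N ξ' θ s x))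

variable (ξ' : Fin N → ℝ) (η θ : ℂ) {α β : EuclideanSpace ℝ (Fin N) → ℂ}

lemma contDiff_modeTerm (hα : ContDiff ℝ (⊤ : ℕ∞) α) (s : ℝ) :
    ContDiff ℝ (⊤ : ℕ∞) (fun x => productCutoff N (s⁻¹ • x) * α x.1
      * Complex.exp (waveExponent N ξ' η s x)) :=
  (((contDiff_productCutoff N).comp (contDiff_const_smul _)).mul (hα.comp contDiff_fst)).mul
    (waveExponent N ξ' η s).contDiff.cexp

lemma contDiff_boundaryMode (hα : ContDiff ℝ (⊤ : ℕ∞) α) (hβ : ContDiff ℝ (⊤ : ℕ∞) β) (s : ℝ) :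
    ContDiff ℝ (⊤ : ℕ∞) (boundaryMode N ξ' η θ α β s) :=
  contDiff_const.mul ((contDiff_modeTerm ξ' η hα s).add (contDiff_modeTerm ξ' θ hβ s))

lemma boundaryMode_eq_zero {s : ℝ} (hs : 0 < s) {x : EuclideanSpace ℝ (Fin N) × ℝ}
    (hx : s ≤ ‖x‖) : boundaryMode N ξ' η θ α β s x = 0 := by
  have : productCutoff N (s⁻¹ • x) = 0 := productCutoff_eq_zero (by
    rw [norm_smul, norm_inv, Real.norm_of_nonneg hs.le, le_inv_mul_iff₀ hs]
    simpa using hx)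
  simp [boundaryMode, this]

lemma pderivC_last_boundaryMode (hα : ContDiff ℝ (⊤ : ℕ∞) α) (hβ : ContDiff ℝ (⊤ : ℕ∞) β)
    (s : ℝ) (x' : EuclideanSpace ℝ (Fin N)) :
    pderivC N (Fin.last N) (boundaryMode N ξ' η θ α β s) (x', 0)
      = Complex.I / ((s ^ 2 : ℝ) : ℂ) *
        boundaryMode N ξ' η θ (fun y => η * α y) (fun y => θ * β y) s (x', 0) := by
  have hA (γ : EuclideanSpace ℝ (Fin N) → ℂ) (hγ : ContDiff ℝ (⊤ : ℕ∞) γ) :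
      ContDiff ℝ (⊤ : ℕ∞) (fun x : EuclideanSpace ℝ (Fin N) × ℝ =>
        productCutoff N (s⁻¹ • x) * γ x.1) :=
    ((contDiff_productCutoff N).comp (contDiff_const_smul _)).mul (hγ.comp contDiff_fst)
  have hfull (η : ℂ) : fullCovec N ξ' η (Fin.last N) = η := by simp [fullCovec]
  unfold boundaryMode
  rw [pderivC_const_mul ((contDiff_modeTerm ξ' η hα s).add (contDiff_modeTerm ξ' θ hβ s)),
    pderivC_add (contDiff_modeTerm ξ' η hα s) (contDiff_modeTerm ξ' θ hβ s),
    pderivC_mul_cexp (hA α hα), pderivC_mul_cexp (hA β hβ)]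
  simp only [pderivC_last_productCutoff_mul hα, pderivC_last_productCutoff_mul hβ,
    waveExponent_coordVec, hfull]
  ring

lemma boundaryMode_boundary_condition (hα : ContDiff ℝ (⊤ : ℕ∞) α) (hβ : ContDiff ℝ (⊤ : ℕ∞) β)
    {s : ℝ} (hs : 0 < s) {x' : EuclideanSpace ℝ (Fin N)} {u w : ℂ}
    (huw : u * (Complex.I * η * α x' + Complex.I * θ * β x') + w * (α x' + β x') = 0) :
    ((s ^ 2 : ℝ) : ℂ) * u * pderivC N (Fin.last N) (boundaryMode N ξ' η θ α β s) (x', 0)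
      + w * boundaryMode N ξ' η θ α β s (x', 0) = 0 := by
  have hs' : ((s ^ 2 : ℝ) : ℂ) ≠ 0 := by
    exact_mod_cast (by positivity : s ^ 2 ≠ 0)
  have he : Complex.exp (waveExponent N ξ' θ s (x', 0))
      = Complex.exp (waveExponent N ξ' η s (x', 0)) := by
    simp [cexp_waveExponent]
  rw [pderivC_last_boundaryMode ξ' η θ hα hβ]
  unfold boundaryMode
  rw [he]
  have hI : ((s ^ 2 : ℝ) : ℂ) * (Complex.I / ((s ^ 2 : ℝ) : ℂ)) = Complex.I := by
    field_simp
  generalize Complex.exp (waveExponent N ξ' η s (x', 0)) = e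
  linear_combination (u * (((Real.sqrt (s ^ (N + 2)))⁻¹ : ℝ) : ℂ) *
      (productCutoff N (s⁻¹ • (x', 0)) * (η * α x' + θ * β x') * e)) * hI
    + ((((Real.sqrt (s ^ (N + 2)))⁻¹ : ℝ) : ℂ) * productCutoff N (s⁻¹ • (x', 0)) * e) * huw

lemma norm_boundaryMode_le {Q δ s : ℝ} (hs : 0 < s) (hδη : δ ≤ η.im) (hδθ : δ ≤ θ.im)
    {x : EuclideanSpace ℝ (Fin N) × ℝ} (hx2 : 0 ≤ x.2) (hα : ‖α x.1‖ ≤ Q) (hβ : ‖β x.1‖ ≤ Q) :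
    ‖boundaryMode N ξ' η θ α β s x‖
      ≤ (Real.sqrt (s ^ (N + 2)))⁻¹ * (2 * Q * Real.exp (-(δ * (x.2 / s ^ 2)))) := by
  have hQ : 0 ≤ Q := (norm_nonneg _).trans hα
  have hy : 0 ≤ x.2 / s ^ 2 := by positivity
  have key (γ : ℂ) (ζ : ℂ) (hγ : ‖γ‖ ≤ Q) (hζ : δ ≤ ζ.im) :
      ‖productCutoff N (s⁻¹ • x) * γ * Complex.exp (waveExponent N ξ' ζ s x)‖
        ≤ 1 * Q * Real.exp (-(δ * (x.2 / s ^ 2))) := by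
    rw [norm_mul, norm_mul, norm_cexp_waveExponent]
    gcongr
    exact norm_productCutoff_le_one _
  unfold boundaryMode
  rw [norm_mul, Complex.norm_real, Real.norm_of_nonneg (by positivity)]
  gcongr
  refine (norm_add_le_of_le (key _ _ hα hδη) (key _ _ hβ hδθ)).trans (le_of_eq ?_)
  ring

lemma norm_boundaryMode_scaled {s : ℝ} (hs : 0 < s) (X : EuclideanSpace ℝ (Fin N) × ℝ) :
    ‖boundaryMode N ξ' η θ α β s (s • X.1, s ^ 2 * X.2)‖
      = (Real.sqrt (s ^ (N + 2)))⁻¹ * (‖productCutoff N (X.1, s * X.2)‖ *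
        ‖α (s • X.1) * Complex.exp (Complex.I * η * (X.2 : ℂ))
          + β (s • X.1) * Complex.exp (Complex.I * θ * (X.2 : ℂ))‖) := by
  have h1 : s⁻¹ • (s • X.1, s ^ 2 * X.2) = (X.1, s * X.2) := by
    ext1
    · simp [smul_smul, hs.ne']
    · simp only [Prod.smul_mk, smul_eq_mul]; field_simp
  have h2 : s ^ 2 * X.2 / s ^ 2 = X.2 := by field_simp
  unfold boundaryMode
  rw [h1]
  simp only [cexp_waveExponent, h2]
  rw [norm_mul, Complex.norm_real, Real.norm_of_nonneg (by positivity)]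
  congr 1
  rw [← norm_mul, ← one_mul ‖productCutoff N (X.1, s * X.2) * _‖,
    ← Complex.norm_exp_ofReal_mul_I (inner ℝ (WithLp.toLp 2 ξ') (s • X.1) / s ^ 2), ← norm_mul]
  congr 1
  ring

end Mode

section Limit

variable {N : ℕ} (ξ' : Fin N → ℝ) (η θ : ℂ) {α β : EuclideanSpace ℝ (Fin N) → ℂ}

lemma measurable_scaledDensity {ρ s : ℝ} {v : EuclideanSpace ℝ (Fin N) × ℝ → ℝ}
    (hv : ContinuousOn v (halfBall N ρ)) {F : EuclideanSpace ℝ (Fin N) × ℝ → ℂ}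
    (hF : Continuous F) : Measurable (scaledDensity N ρ v s F) := by
  classical
  have hvm : Measurable ((halfBall N ρ).indicator v) := by
    rw [← Set.piecewise_eq_indicator]
    exact hv.measurable_piecewise continuousOn_const (measurableSet_halfBall N ρ)
  have hS : Measurable fun X : EuclideanSpace ℝ (Fin N) × ℝ => (s • X.1, s ^ 2 * X.2) := by
    fun_prop
  have heq : (halfBall N ρ).indicator
      (fun x => ENNReal.ofReal (s ^ (N + 2)) * (ENNReal.ofReal (v x) * ‖F x‖ₑ ^ 2))
      = fun x => ENNReal.ofReal (s ^ (N + 2)) *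
        (ENNReal.ofReal ((halfBall N ρ).indicator v x) * ‖F x‖ₑ ^ 2) := by
    funext x
    by_cases hx : x ∈ halfBall N ρ <;> simp [hx]
  have hm : Measurable ((halfBall N ρ).indicator
      (fun x => ENNReal.ofReal (s ^ (N + 2)) * (ENNReal.ofReal (v x) * ‖F x‖ₑ ^ 2))) := by
    rw [heq]
    exact (hvm.ennreal_ofReal.mul (hF.measurable.enorm.pow_const 2)).const_mul _
  exact hm.comp hS

/-- The pointwise limit of the scaled densities of the boundary modes. -/
noncomputable def limitDensity (N : ℕ) (κ : ℝ) (η θ A B : ℂ)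
    (X : EuclideanSpace ℝ (Fin N) × ℝ) : ℝ≥0∞ :=
  {X : EuclideanSpace ℝ (Fin N) × ℝ | 0 ≤ X.2}.indicator
    (fun X => ENNReal.ofReal (κ * (‖productCutoff N (X.1, 0)‖ *
      ‖A * Complex.exp (Complex.I * η * (X.2 : ℂ))
        + B * Complex.exp (Complex.I * θ * (X.2 : ℂ))‖) ^ 2)) X

lemma tendsto_scaledDensity_boundaryMode {ρ : ℝ} (hρ : 0 < ρ)
    {v : EuclideanSpace ℝ (Fin N) × ℝ → ℝ} (hv : ContinuousOn v (halfBall N ρ))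
    (hvpos : ∀ x ∈ halfBall N ρ, 0 < v x)
    (hα : Continuous α) (hβ : Continuous β) (X : EuclideanSpace ℝ (Fin N) × ℝ) :
    Filter.Tendsto (fun s => scaledDensity N ρ v s (boundaryMode N ξ' η θ α β s) X)
      (𝓝[>] 0) (𝓝 (limitDensity N (v 0) η θ (α 0) (β 0) X)) := by
  have hpos : ∀ᶠ s : ℝ in 𝓝[>] 0, 0 < s := eventually_mem_nhdsWithin
  rcases lt_or_ge X.2 0 with hX | hX
  · have h0 : limitDensity N (v 0) η θ (α 0) (β 0) X = 0 :=
      Set.indicator_of_notMem (by simpa using hX) _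
    rw [h0]
    refine tendsto_const_nhds.congr' ?_
    filter_upwards [hpos] with s hs
    refine (Set.indicator_of_notMem (fun h => ?_) _).symm
    have h1 : 0 ≤ s ^ 2 * X.2 := h.1
    have h2 : 0 < s ^ 2 := by positivity
    nlinarith
  have hlim : limitDensity N (v 0) η θ (α 0) (β 0) X
      = ENNReal.ofReal (v 0 * (‖productCutoff N (X.1, 0)‖ *
      ‖α 0 * Complex.exp (Complex.I * η * (X.2 : ℂ))
        + β 0 * Complex.exp (Complex.I * θ * (X.2 : ℂ))‖) ^ 2) :=
    Set.indicator_of_mem (by simpa using hX) _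
  have hS : Filter.Tendsto (fun s : ℝ => (s • X.1, s ^ 2 * X.2)) (𝓝[>] 0) (𝓝 0) := by
    have : Continuous fun s : ℝ => (s • X.1, s ^ 2 * X.2) := by fun_prop
    have h := this.tendsto 0
    simp only [zero_smul, ne_eq, OfNat.ofNat_ne_zero, not_false_eq_true, zero_pow, zero_mul] at h
    exact h.mono_left nhdsWithin_le_nhds
  have hmem : ∀ᶠ s : ℝ in 𝓝[>] 0, (s • X.1, s ^ 2 * X.2) ∈ halfBall N ρ := by
    have hc : Continuous fun x : EuclideanSpace ℝ (Fin N) × ℝ =>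
      Real.sqrt (‖x.1‖ ^ 2 + x.2 ^ 2) := by fun_prop
    have h : ∀ᶠ s : ℝ in 𝓝[>] 0, Real.sqrt (‖s • X.1‖ ^ 2 + (s ^ 2 * X.2) ^ 2) < ρ :=
      ((hc.tendsto 0).comp hS).eventually (Iio_mem_nhds (by simpa using hρ))
    filter_upwards [h, hpos] with s h1 hs
    exact ⟨by positivity, h1⟩
  have hvlim : Filter.Tendsto (fun s : ℝ => v (s • X.1, s ^ 2 * X.2)) (𝓝[>] 0) (𝓝 (v 0)) :=
    (hv 0 (zero_mem_halfBall hρ)).tendsto.comp (tendsto_nhdsWithin_iff.2 ⟨hS, hmem⟩)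
  have hrest : Filter.Tendsto (fun s : ℝ => (‖productCutoff N (X.1, s * X.2)‖ *
      ‖α (s • X.1) * Complex.exp (Complex.I * η * (X.2 : ℂ))
        + β (s • X.1) * Complex.exp (Complex.I * θ * (X.2 : ℂ))‖) ^ 2) (𝓝[>] 0)
      (𝓝 ((‖productCutoff N (X.1, 0)‖ * ‖α 0 * Complex.exp (Complex.I * η * (X.2 : ℂ))
        + β 0 * Complex.exp (Complex.I * θ * (X.2 : ℂ))‖) ^ 2)) := by
    have hB := (contDiff_productCutoff N).continuous
    have hc : Continuous fun s : ℝ => (‖productCutoff N (X.1, s * X.2)‖ *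
      ‖α (s • X.1) * Complex.exp (Complex.I * η * (X.2 : ℂ))
        + β (s • X.1) * Complex.exp (Complex.I * θ * (X.2 : ℂ))‖) ^ 2 := by fun_prop
    have h := hc.tendsto 0
    simp only [zero_mul, zero_smul] at h
    exact h.mono_left nhdsWithin_le_nhds
  rw [hlim]
  refine (ENNReal.tendsto_ofReal (hvlim.mul hrest)).congr' ?_
  filter_upwards [hmem, hpos] with s hsU hs
  have hsp : 0 < s ^ (N + 2) := by positivity
  unfold scaledDensity
  rw [Set.indicator_of_mem hsU, ← ofReal_norm, norm_boundaryMode_scaled ξ' η θ hs,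
    ← ENNReal.ofReal_pow (by positivity), ← ENNReal.ofReal_mul (hvpos _ hsU).le,
    ← ENNReal.ofReal_mul hsp.le, mul_pow (Real.sqrt (s ^ (N + 2)))⁻¹ _ 2,
    inv_pow, Real.sq_sqrt hsp.le]
  congr 1
  field_simp

/-- Two distinct exponentials are linearly independent on the positive half-line. -/
lemma exists_pos_combination_ne_zero {η θ : ℂ} (hne : η ≠ θ) {A B : ℂ} (hAB : ¬(A = 0 ∧ B = 0)) :
    ∃ y : ℝ, 0 < y ∧ A * Complex.exp (Complex.I * η * (y : ℂ))
      + B * Complex.exp (Complex.I * θ * (y : ℂ)) ≠ 0 := by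
  by_contra! hcon
  have hc : Continuous fun y : ℝ => A * Complex.exp (Complex.I * η * (y : ℂ))
      + B * Complex.exp (Complex.I * θ * (y : ℂ)) := by fun_prop
  have hexp (ζ : ℂ) : HasDerivAt (fun y : ℝ => Complex.exp (Complex.I * ζ * (y : ℂ)))
      (Complex.I * ζ) 0 := by
    have h := (((hasDerivAt_id (0 : ℝ)).ofReal_comp).const_mul (Complex.I * ζ)).cexp
    simpa using h
  have hd := ((hexp η).const_mul A).add ((hexp θ).const_mul B)
  have h0 : A + B = 0 := by
    have h1 : Filter.Tendsto (fun y : ℝ => A * Complex.exp (Complex.I * η * (y : ℂ))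
      + B * Complex.exp (Complex.I * θ * (y : ℂ))) (𝓝[>] 0) (𝓝 0) :=
      tendsto_const_nhds.congr' (by
        filter_upwards [self_mem_nhdsWithin] with y hy using (hcon y hy).symm)
    have h2 := tendsto_nhds_unique h1 ((hc.tendsto 0).mono_left nhdsWithin_le_nhds)
    simpa using h2.symm
  have hzero : ∀ y ∈ Set.Ici (0 : ℝ), A * Complex.exp (Complex.I * η * (y : ℂ))
      + B * Complex.exp (Complex.I * θ * (y : ℂ)) = 0 := by
    intro y hy
    rcases (Set.mem_Ici.1 hy).eq_or_lt with rfl | hy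
    · simpa using h0
    · exact hcon y hy
  have hd0 : HasDerivWithinAt (fun y : ℝ => A * Complex.exp (Complex.I * η * (y : ℂ))
      + B * Complex.exp (Complex.I * θ * (y : ℂ))) 0 (Set.Ici 0) 0 :=
    (hasDerivWithinAt_const (0 : ℝ) (Set.Ici 0) (0 : ℂ)).congr hzero (hzero 0 Set.self_mem_Ici)
  have h1 : A * (Complex.I * η) + B * (Complex.I * θ) = 0 :=
    (uniqueDiffWithinAt_Ici 0).eq_deriv _ hd.hasDerivWithinAt hd0
  have h2 : A * η + B * θ = 0 := by
    have : Complex.I * (A * η + B * θ) = 0 := by linear_combination h1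
    exact (mul_eq_zero.1 this).resolve_left Complex.I_ne_zero
  have h3 : A * (η - θ) = 0 := by linear_combination h2 - θ * h0
  have hA : A = 0 := (mul_eq_zero.1 h3).resolve_right (sub_ne_zero.2 hne)
  exact hAB ⟨hA, by simpa [hA] using h0⟩

lemma lintegral_limitDensity_ne_zero {κ : ℝ} (hκ : 0 < κ) {η θ : ℂ} (hne : η ≠ θ) {A B : ℂ}
    (hAB : ¬(A = 0 ∧ B = 0)) : ∫⁻ X, limitDensity N κ η θ A B X ≠ 0 := by
  have hB := (contDiff_productCutoff N).continuous
  have hcont : Continuous fun X : EuclideanSpace ℝ (Fin N) × ℝ => ‖productCutoff N (X.1, 0)‖ *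
      ‖A * Complex.exp (Complex.I * η * (X.2 : ℂ))
        + B * Complex.exp (Complex.I * θ * (X.2 : ℂ))‖ := by fun_prop
  have hm : Measurable (limitDensity N κ η θ A B) :=
    Measurable.indicator (by fun_prop) (measurableSet_le measurable_const measurable_snd)
  refine ((lintegral_pos_iff_support hm).2 ?_).ne'
  obtain ⟨y, hy, hyne⟩ := exists_pos_combination_ne_zero hne hAB
  have hopen : IsOpen {X : EuclideanSpace ℝ (Fin N) × ℝ | 0 < X.2 ∧
      0 < ‖productCutoff N (X.1, 0)‖ * ‖A * Complex.exp (Complex.I * η * (X.2 : ℂ))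
        + B * Complex.exp (Complex.I * θ * (X.2 : ℂ))‖} :=
    (isOpen_lt continuous_const continuous_snd).inter (isOpen_lt continuous_const hcont)
  refine (hopen.measure_pos volume ⟨(0, y), hy, ?_⟩).trans_le (measure_mono ?_)
  · have : productCutoff N (0, 0) = 1 := productCutoff_zero
    simpa [this] using hyne
  · rintro X ⟨h1, h2⟩
    rw [Function.mem_support, limitDensity, Set.indicator_of_mem (by exact h1.le)]
    exact (ENNReal.ofReal_pos.2 (by positivity)).ne'

lemma tendsto_eLpNorm_boundaryMode {ρ : ℝ} (hρ : 0 < ρ)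
    {v : EuclideanSpace ℝ (Fin N) × ℝ → ℝ} (hv : ContDiffOn ℝ (⊤ : ℕ∞) v (halfBall N ρ))
    (hvpos : ∀ x ∈ halfBall N ρ, 0 < v x) {η θ : ℂ} (hne : η ≠ θ) (hη : 0 < η.im) (hθ : 0 < θ.im)
    (hα : ContDiff ℝ (⊤ : ℕ∞) α) (hβ : ContDiff ℝ (⊤ : ℕ∞) β) (hαβ : ¬(α 0 = 0 ∧ β 0 = 0)) :
    ∃ c₀ > (0 : ℝ), Filter.Tendsto (fun s => (eLpNorm (boundaryMode N ξ' η θ α β s) 2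
      ((volume.restrict (halfBall N ρ)).withDensity (fun x => ENNReal.ofReal (v x)))).toReal)
      (𝓝[>] 0) (𝓝 c₀) := by
  obtain ⟨Mv, hMv, hev⟩ := hv.eventually_norm_le_and_norm_sub_le (zero_mem_halfBall hρ)
  obtain ⟨r, hr, hev⟩ := Metric.mem_nhdsWithin_iff.1 hev
  have hcpt : IsCompact (Metric.closedBall (0 : EuclideanSpace ℝ (Fin N)) 1) :=
    isCompact_closedBall _ _
  obtain ⟨Q₁, hQ₁⟩ := hcpt.exists_bound_of_continuousOn hα.continuous.continuousOn
  obtain ⟨Q₂, hQ₂⟩ := hcpt.exists_bound_of_continuousOn hβ.continuous.continuousOn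
  set δ := min η.im θ.im
  have hδ : 0 < δ := lt_min hη hθ
  have hpos : ∀ᶠ s : ℝ in 𝓝[>] 0, 0 < s := eventually_mem_nhdsWithin
  have hsmall : ∀ᶠ s : ℝ in 𝓝[>] 0, s < min r 1 :=
    (gt_mem_nhds (by positivity)).filter_mono nhdsWithin_le_nhds
  have hbound : ∀ᶠ s : ℝ in 𝓝[>] 0, ∀ X,
      scaledDensity N ρ v s (boundaryMode N ξ' η θ α β s) X
        ≤ ENNReal.ofReal ((2 * max Q₁ Q₂) ^ 2 * Mv) * dominatingProfile N δ X := by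
    filter_upwards [hpos, hsmall] with s hs hsr X
    refine scaledDensity_le_dominatingProfile hs hvpos (fun x hx hxs => ?_) (fun x hx hxs => ?_)
      (fun x _ hxs => boundaryMode_eq_zero ξ' η θ hs hxs.le) X
    · exact (le_abs_self _).trans (hev (a := x)
        ⟨by simpa using hxs.trans_lt (hsr.trans_le (min_le_left _ _)), hx⟩).1
    · have hx1 : x.1 ∈ Metric.closedBall (0 : EuclideanSpace ℝ (Fin N)) 1 := by
        simpa using (norm_fst_le x).trans (hxs.trans (hsr.trans_le (min_le_right _ _)).le)
      exact norm_boundaryMode_le ξ' η θ hs (min_le_left _ _) (min_le_right _ _) hx.1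
        ((hQ₁ _ hx1).trans (le_max_left _ _)) ((hQ₂ _ hx1).trans (le_max_right _ _))
  have hfin : ∫⁻ X, ENNReal.ofReal ((2 * max Q₁ Q₂) ^ 2 * Mv) * dominatingProfile N δ X ≠ ∞ := by
    rw [lintegral_const_mul' _ _ (by simp)]
    exact ENNReal.mul_ne_top (by simp) (lintegral_dominatingProfile_ne_top hδ)
  have hptw := tendsto_scaledDensity_boundaryMode ξ' η θ hρ hv.continuousOn hvpos
    hα.continuous hβ.continuous
  have hlim := tendsto_lintegral_filter_of_dominated_convergence (μ := volume) (l := 𝓝[>] (0 : ℝ))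
    _ (Filter.Eventually.of_forall fun s => measurable_scaledDensity (s := s) hv.continuousOn
      (contDiff_boundaryMode ξ' η θ hα hβ s).continuous)
    (hbound.mono fun s h => Filter.Eventually.of_forall h) hfin
    (Filter.Eventually.of_forall hptw)
  set J := ∫⁻ X, limitDensity N (v 0) η θ (α 0) (β 0) X
  have hJ0 : J ≠ 0 := lintegral_limitDensity_ne_zero (hvpos 0 (zero_mem_halfBall hρ)) hne hαβ
  have hJtop : J ≠ ∞ := by
    refine ne_top_of_le_ne_top hfin (lintegral_mono fun X => ?_)
    exact le_of_tendsto (hptw X) (hbound.mono fun s h => h X)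
  have hJr : J ^ (1 / 2 : ℝ) ≠ ∞ := by simp [hJtop]
  refine ⟨(J ^ (1 / 2 : ℝ)).toReal, ENNReal.toReal_pos (by simp [hJ0]) hJr, ?_⟩
  refine ((ENNReal.tendsto_toReal hJr).comp
    ((ENNReal.continuous_rpow_const.tendsto J).comp hlim)).congr' ?_
  filter_upwards [hpos] with s hs
  simp only [Function.comp_apply]
  rw [eLpNorm_eq_lintegral_scaledDensity hs hv.continuousOn]

end Limit

section Defect

variable {N : ℕ} (ξ' : Fin N → ℝ)

lemma exists_eLpNorm_defect_boundaryMode_le {ρ : ℝ} (hρ : 0 < ρ)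
    {a : Fin (N+1) → Fin (N+1) → EuclideanSpace ℝ (Fin N) × ℝ → ℂ}
    {b b₁ : Fin (N+1) → EuclideanSpace ℝ (Fin N) × ℝ → ℂ}
    {c c₁ c₂ : EuclideanSpace ℝ (Fin N) × ℝ → ℂ} {v : EuclideanSpace ℝ (Fin N) × ℝ → ℝ}
    (ha : ∀ j k, ContDiffOn ℝ (⊤ : ℕ∞) (a j k) (halfBall N ρ))
    (hb : ∀ j, ContDiffOn ℝ (⊤ : ℕ∞) (b j) (halfBall N ρ))
    (hb₁ : ∀ j, ContDiffOn ℝ (⊤ : ℕ∞) (b₁ j) (halfBall N ρ))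
    (hc : ContDiffOn ℝ (⊤ : ℕ∞) c (halfBall N ρ)) (hc₁ : ContDiffOn ℝ (⊤ : ℕ∞) c₁ (halfBall N ρ))
    (hc₂ : ContDiffOn ℝ (⊤ : ℕ∞) c₂ (halfBall N ρ))
    (hv : ContDiffOn ℝ (⊤ : ℕ∞) v (halfBall N ρ)) (hvpos : ∀ x ∈ halfBall N ρ, 0 < v x)
    {z η θ : ℂ} (hη : 0 < η.im) (hθ : 0 < θ.im)
    (hzη : principalSymbol N a b c (fullCovec N ξ' η) 0 = z)
    (hzθ : principalSymbol N a b c (fullCovec N ξ' θ) 0 = z)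
    {α β : EuclideanSpace ℝ (Fin N) → ℂ}
    (hα : ContDiff ℝ (⊤ : ℕ∞) α) (hβ : ContDiff ℝ (⊤ : ℕ∞) β) :
    ∃ C, 0 < C ∧ ∃ r, 0 < r ∧ ∀ s : ℝ, 0 < s → s < r →
      eLpNorm (semiclassicalDefect N a b b₁ c c₁ c₂ z (s ^ 2) (boundaryMode N ξ' η θ α β s)) 2
        ((volume.restrict (halfBall N ρ)).withDensity (fun x => ENNReal.ofReal (v x)))
        ≤ ENNReal.ofReal (C * s) := by
  obtain ⟨Mv, hMv, hev⟩ := hv.eventually_norm_le_and_norm_sub_le (zero_mem_halfBall hρ)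
  obtain ⟨rv, hrv, hev⟩ := Metric.mem_nhdsWithin_iff.1 hev
  obtain ⟨C₁, hC₁, r₁, hr₁, hd₁⟩ := exists_defect_bound hρ ha hb hb₁ hc hc₁ hc₂ z _ hzη
    (contDiff_productCutoff N) (hα.comp contDiff_fst)
  obtain ⟨C₂, hC₂, r₂, hr₂, hd₂⟩ := exists_defect_bound hρ ha hb hb₁ hc hc₁ hc₂ z _ hzθ
    (contDiff_productCutoff N) (hβ.comp contDiff_fst)
  set δ := min η.im θ.im
  have hδ : 0 < δ := lt_min hη hθ
  have hItop := lintegral_dominatingProfile_ne_top (N := N) hδ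
  set J := ∫⁻ X, dominatingProfile N δ X
  have hJ : 0 ≤ J.toReal := ENNReal.toReal_nonneg
  refine ⟨(C₁ + C₂) * Real.sqrt (Mv * J.toReal) + 1, by positivity, min rv (min r₁ r₂),
    by positivity, fun s hs hsr => ?_⟩
  have hsv : s < rv := hsr.trans_le (min_le_left _ _)
  have hs₁ : s < r₁ := hsr.trans_le ((min_le_right _ _).trans (min_le_left _ _))
  have hs₂ : s < r₂ := hsr.trans_le ((min_le_right _ _).trans (min_le_right _ _))
  have hbound (X : EuclideanSpace ℝ (Fin N) × ℝ) : scaledDensity N ρ v s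
      (semiclassicalDefect N a b b₁ c c₁ c₂ z (s ^ 2) (boundaryMode N ξ' η θ α β s)) X
        ≤ ENNReal.ofReal (((C₁ + C₂) * s) ^ 2 * Mv) * dominatingProfile N δ X := by
    refine scaledDensity_le_dominatingProfile hs hvpos (fun x hx hxs => ?_) (fun x hx hxs => ?_)
      (fun x _ hxs => ?_) X
    · exact (le_abs_self _).trans (hev (a := x) ⟨by simpa using hxs.trans_lt hsv, hx⟩).1
    · have e₁ := hd₁ s hs hs₁ _ (waveExponent_coordVec ξ' η s) x hx hxs
      have e₂ := hd₂ s hs hs₂ _ (waveExponent_coordVec ξ' θ s) x hx hxs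
      rw [norm_cexp_waveExponent] at e₁ e₂
      have hy : 0 ≤ x.2 / s ^ 2 := div_nonneg hx.1 (by positivity)
      have hηδ : Real.exp (-(η.im * (x.2 / s ^ 2))) ≤ Real.exp (-(δ * (x.2 / s ^ 2))) := by
        gcongr
        exact min_le_left _ _
      have hθδ : Real.exp (-(θ.im * (x.2 / s ^ 2))) ≤ Real.exp (-(δ * (x.2 / s ^ 2))) := by
        gcongr
        exact min_le_right _ _
      have hlin := semiclassicalDefect_const_mul_add a b b₁ c c₁ c₂ z (s ^ 2)
        (contDiff_modeTerm ξ' η hα s) (contDiff_modeTerm ξ' θ hβ s)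
        (((Real.sqrt (s ^ (N + 2)))⁻¹ : ℝ) : ℂ) x
      change ‖semiclassicalDefect N a b b₁ c c₁ c₂ z (s ^ 2) (fun x =>
        (((Real.sqrt (s ^ (N + 2)))⁻¹ : ℝ) : ℂ) *
          (productCutoff N (s⁻¹ • x) * α x.1 * Complex.exp (waveExponent N ξ' η s x)
          + productCutoff N (s⁻¹ • x) * β x.1 * Complex.exp (waveExponent N ξ' θ s x))) x‖ ≤ _
      rw [hlin, norm_mul, Complex.norm_real, Real.norm_of_nonneg (by positivity)]
      gcongr
      refine (norm_add_le_of_le e₁ e₂).trans ?_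
      calc _ ≤ C₁ * s * Real.exp (-(δ * (x.2 / s ^ 2))) + C₂ * s * Real.exp (-(δ * (x.2 / s ^ 2))) := by
            gcongr
        _ = _ := by ring
    · refine semiclassicalDefect_eq_zero_of_eventuallyEq a b b₁ c c₁ c₂ z (s ^ 2) ?_
      filter_upwards [(isOpen_lt continuous_const continuous_norm).mem_nhds hxs] with y hy
      exact boundaryMode_eq_zero ξ' η θ hs (le_of_lt hy)
  rw [eLpNorm_eq_lintegral_scaledDensity hs hv.continuousOn]
  calc _ ≤ (ENNReal.ofReal (((C₁ + C₂) * s) ^ 2 * Mv) * J) ^ (1 / 2 : ℝ) := by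
        rw [← lintegral_const_mul' _ _ (by simp)]
        gcongr
        exact hbound _
    _ = ENNReal.ofReal (Real.sqrt (((C₁ + C₂) * s) ^ 2 * Mv * J.toReal)) := by
        rw [← ENNReal.ofReal_toReal hItop, ← ENNReal.ofReal_mul (by positivity),
          ENNReal.ofReal_rpow_of_nonneg (by positivity) (by norm_num), Real.sqrt_eq_rpow,
          ENNReal.toReal_ofReal hJ]
    _ ≤ _ := by
        refine ENNReal.ofReal_le_ofReal ?_
        rw [mul_assoc, Real.sqrt_mul (by positivity), Real.sqrt_sq (by positivity)]
        linarith

/-- The amplitude `f` multiplied by a cutoff supported in the ball of radius `ρ`. -/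
noncomputable def boundaryAmplitude {ρ : ℝ} (hρ : 0 < ρ) (f : EuclideanSpace ℝ (Fin N) → ℂ)
    (x' : EuclideanSpace ℝ (Fin N)) : ℂ :=
  (((⟨ρ / 4, ρ / 2, by positivity, by linarith⟩ :
    ContDiffBump (0 : EuclideanSpace ℝ (Fin N))) x' : ℝ) : ℂ) * f x'

lemma boundaryAmplitude_zero {ρ : ℝ} (hρ : 0 < ρ) (f : EuclideanSpace ℝ (Fin N) → ℂ) :
    boundaryAmplitude hρ f 0 = f 0 := by
  rw [boundaryAmplitude, ContDiffBump.one_of_mem_closedBall _ (by simp; positivity)]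
  simp

lemma contDiff_boundaryAmplitude {ρ : ℝ} (hρ : 0 < ρ) {f : EuclideanSpace ℝ (Fin N) → ℂ}
    (hf : ContDiffOn ℝ (⊤ : ℕ∞) f {x' : EuclideanSpace ℝ (Fin N) | ‖x'‖ < ρ}) :
    ContDiff ℝ (⊤ : ℕ∞) (boundaryAmplitude hρ f) := by
  set χ : ContDiffBump (0 : EuclideanSpace ℝ (Fin N)) :=
    ⟨ρ / 4, ρ / 2, by positivity, by linarith⟩ with hχ
  have hχC : ContDiff ℝ (⊤ : ℕ∞) (fun x' => ((χ x' : ℝ) : ℂ)) :=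
    Complex.ofRealCLM.contDiff.comp χ.contDiff
  rw [contDiff_iff_contDiffAt]
  intro x'
  rcases lt_or_ge ‖x'‖ ρ with hx | hx
  · exact hχC.contDiffAt.mul
      (hf.contDiffAt ((isOpen_lt continuous_norm continuous_const).mem_nhds hx))
  · have hlt : ρ / 2 < ‖x'‖ := by linarith
    refine (contDiffAt_const (c := (0 : ℂ))).congr_of_eventuallyEq ?_
    filter_upwards [(isOpen_lt continuous_const continuous_norm).mem_nhds hlt] with y hy
    have : χ y = 0 := χ.zero_of_le_dist (by simpa [hχ] using le_of_lt hy)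
    change ((χ y : ℝ) : ℂ) * f y = 0
    simp [this]

end Defect

/-- Theorem 15 (higher-dimensional boundary pseudo-eigenfunctions with boundary
conditions): under the admissibility/exit condition — the two roots `ξ_N ≠ ξ̃_N` of
`σ(0,(ξ',s)) = z` both have positive imaginary part — and non-degenerate boundary
conditions `h u(x') ∂_N f(x',0) + w(x') f(x',0) = 0`, there are smooth functions `g_h`
satisfying the boundary conditions, supported in balls of radius `O(h^{1/2})`, with
`‖g_h‖ → c > 0` and `‖L_h g_h - z g_h‖ = O(h^{1/2})` in `L²(v dx)`. -/
theorem boundary_pseudoeigenfunctions_higher_dim_bc (N : ℕ) (ρ : ℝ) (hρ : 0 < ρ)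
    (a : Fin (N+1) → Fin (N+1) → EuclideanSpace ℝ (Fin N) × ℝ → ℂ)
    (b b₁ : Fin (N+1) → EuclideanSpace ℝ (Fin N) × ℝ → ℂ)
    (c c₁ c₂ : EuclideanSpace ℝ (Fin N) × ℝ → ℂ)
    (v : EuclideanSpace ℝ (Fin N) × ℝ → ℝ)
    (ha : ∀ j k, ContDiffOn ℝ (⊤ : ℕ∞) (a j k) (halfBall N ρ))
    (hb : ∀ j, ContDiffOn ℝ (⊤ : ℕ∞) (b j) (halfBall N ρ))
    (hb₁ : ∀ j, ContDiffOn ℝ (⊤ : ℕ∞) (b₁ j) (halfBall N ρ))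
    (hc : ContDiffOn ℝ (⊤ : ℕ∞) c (halfBall N ρ)) (hc₁ : ContDiffOn ℝ (⊤ : ℕ∞) c₁ (halfBall N ρ))
    (hc₂ : ContDiffOn ℝ (⊤ : ℕ∞) c₂ (halfBall N ρ))
    (hv : ContDiffOn ℝ (⊤ : ℕ∞) v (halfBall N ρ)) (hvpos : ∀ x ∈ halfBall N ρ, 0 < v x)
    (u w : EuclideanSpace ℝ (Fin N) → ℂ)
    (hu : ContDiffOn ℝ (⊤ : ℕ∞) u {x' : EuclideanSpace ℝ (Fin N) | ‖x'‖ < ρ})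
    (hw : ContDiffOn ℝ (⊤ : ℕ∞) w {x' : EuclideanSpace ℝ (Fin N) | ‖x'‖ < ρ})
    (huw : ¬(u 0 = 0 ∧ w 0 = 0))
    (ξ' : Fin N → ℝ) (z : ℂ) (ξN ξN' : ℂ) (hne : ξN ≠ ξN')
    (himN : 0 < ξN.im) (himN' : 0 < ξN'.im)
    (hroot : (∑ j, ∑ k, a j k 0 * fullCovec N ξ' ξN j * fullCovec N ξ' ξN k)
        + (∑ j, b j 0 * fullCovec N ξ' ξN j) + c 0 = z)
    (hroot' : (∑ j, ∑ k, a j k 0 * fullCovec N ξ' ξN' j * fullCovec N ξ' ξN' k)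
        + (∑ j, b j 0 * fullCovec N ξ' ξN' j) + c 0 = z) :
    ∃ c₀ > (0:ℝ), ∃ c' > (0:ℝ), ∃ C > (0:ℝ), ∃ h₀ > (0:ℝ),
    ∃ g : ℝ → (EuclideanSpace ℝ (Fin N) × ℝ → ℂ),
      Filter.Tendsto
        (fun h => (eLpNorm (g h) 2
          ((volume.restrict (halfBall N ρ)).withDensity
            (fun x => ENNReal.ofReal (v x)))).toReal)
        (𝓝[>] 0) (𝓝 c₀) ∧
      ∀ h ∈ Set.Ioc (0:ℝ) h₀,
        ContDiff ℝ (⊤ : ℕ∞) (g h) ∧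
        (∀ x' : EuclideanSpace ℝ (Fin N), ‖x'‖ < ρ →
          (h:ℂ) * u x' * pderivC N (Fin.last N) (g h) (x', 0) + w x' * g h (x', 0) = 0) ∧
        (∀ x : EuclideanSpace ℝ (Fin N) × ℝ,
          c' * h ^ ((1:ℝ)/2) < Real.sqrt (‖x.1‖^2 + x.2^2) → g h x = 0) ∧
        eLpNorm (fun x =>
            (-(h:ℂ)^2 * ∑ j, ∑ k, a j k x * pderivC N j (pderivC N k (g h)) x
              - Complex.I * (h:ℂ) * ∑ j, (b j x + (h:ℂ) * b₁ j x) * pderivC N j (g h) x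
              + (c x + (h:ℂ) * c₁ x + (h:ℂ)^2 * c₂ x) * g h x)
            - z * g h x) 2
          ((volume.restrict (halfBall N ρ)).withDensity (fun x => ENNReal.ofReal (v x)))
          ≤ ENNReal.ofReal (C * h ^ ((1:ℝ)/2)) := by
  have hα : ContDiff ℝ (⊤ : ℕ∞) (boundaryAmplitude hρ (fun x' => Complex.I * ξN' * u x' + w x')) :=
    contDiff_boundaryAmplitude hρ ((contDiffOn_const.mul hu).add hw)
  have hβ : ContDiff ℝ (⊤ : ℕ∞)
      (boundaryAmplitude hρ (fun x' => -(Complex.I * ξN * u x' + w x'))) :=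
    contDiff_boundaryAmplitude hρ ((contDiffOn_const.mul hu).add hw).neg
  set α := boundaryAmplitude hρ (fun x' => Complex.I * ξN' * u x' + w x') with hαdef
  set β := boundaryAmplitude hρ (fun x' => -(Complex.I * ξN * u x' + w x')) with hβdef
  have hαβ : ¬(α 0 = 0 ∧ β 0 = 0) := by
    rw [hαdef, hβdef, boundaryAmplitude_zero, boundaryAmplitude_zero]
    rintro ⟨h1, h2⟩
    have h3 : (ξN' - ξN) * (Complex.I * u 0) = 0 := by linear_combination h1 + h2
    have hu0 : u 0 = 0 := by
      have := (mul_eq_zero.1 h3).resolve_left (sub_ne_zero.2 hne.symm)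
      exact (mul_eq_zero.1 this).resolve_left Complex.I_ne_zero
    exact huw ⟨hu0, by simpa [hu0] using h1⟩
  obtain ⟨c₀, hc₀, hlim⟩ :=
    tendsto_eLpNorm_boundaryMode ξ' hρ hv hvpos hne himN himN' hα hβ hαβ
  obtain ⟨C, hC, r, hr, hdef⟩ := exists_eLpNorm_defect_boundaryMode_le ξ' hρ ha hb hb₁ hc hc₁ hc₂
    hv hvpos himN himN' hroot hroot' hα hβ
  refine ⟨c₀, hc₀, 2, two_pos, C, hC, (r / 2) ^ 2, by positivity,
    fun h => boundaryMode N ξ' ξN ξN' α β (Real.sqrt h), ?_, ?_⟩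
  · refine hlim.comp (tendsto_nhdsWithin_iff.2 ⟨?_, ?_⟩)
    · have := Real.continuous_sqrt.tendsto 0
      rw [Real.sqrt_zero] at this
      exact this.mono_left nhdsWithin_le_nhds
    · filter_upwards [self_mem_nhdsWithin] with h hh using Real.sqrt_pos.2 hh
  rintro h ⟨hh, hhr⟩
  obtain ⟨s, hs, rfl⟩ : ∃ s : ℝ, 0 < s ∧ s ^ 2 = h :=
    ⟨Real.sqrt h, Real.sqrt_pos.2 hh, Real.sq_sqrt hh.le⟩
  have hsr : s < r := by
    have := le_of_sq_le_sq hhr (by positivity)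
    linarith
  simp only [← Real.sqrt_eq_rpow, Real.sqrt_sq hs.le]
  refine ⟨contDiff_boundaryMode ξ' ξN ξN' hα hβ s, fun x' _ => ?_, fun x hx => ?_, hdef s hs hsr⟩
  · refine boundaryMode_boundary_condition ξ' ξN ξN' hα hβ hs ?_
    simp only [hαdef, hβdef, boundaryAmplitude]
    ring
  · refine boundaryMode_eq_zero ξ' ξN ξN' hs ?_
    have h1 := norm_fst_le x
    have h2 := norm_snd_le x
    have h3 : Real.sqrt (‖x.1‖ ^ 2 + x.2 ^ 2) ≤ ‖x.1‖ + ‖x.2‖ := by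
      rw [Real.sqrt_le_iff, ← sq_abs x.2, ← Real.norm_eq_abs]
      refine ⟨by positivity, ?_⟩
      nlinarith [mul_nonneg (norm_nonneg x.1) (norm_nonneg x.2)]
    linarith
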